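/- arXiv:2511.21791 — 2 statements merged into one kernel-verified Lean document; each statement's English description precedes it below -/
import Mathlib

section
/- Let S be a finite thick generalized quadrangle, let r and r' be distinct primes, and let x, y be two noncollinear points such that r divides |Ẽ(x)| and r' divides |Ẽ(y)|. Then there exist two distinct (necessarily noncollinear) points u, v in the hyperbolic line {x,y}^{⊥⊥} and a nontrivial element g of ⟨Ẽ(w) : w ∈ {x,y}^{⊥⊥}⟩ that fixes every line incident with u and every line incident with v (i.e., g is a nontrivial homology with centers u and v). -/
open Equiv

section GQDefs

variable {P L : Type*}

/-- A generalized quadrangle of order `(s,t)`: every line has `s+1` points, every point is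
on `t+1` lines, two distinct points are on at most one common line, and for every
non-incident point-line pair `(p, ℓ)` there is a unique pair `(q, M)` with `M` a line
through `p` and `q` a point incident with both `M` and `ℓ`. -/
structure IsGQ (I : P → L → Prop) (s t : ℕ) : Prop where
  point_count : ∀ ℓ : L, Nat.card {p : P // I p ℓ} = s + 1
  line_count : ∀ p : P, Nat.card {ℓ : L // I p ℓ} = t + 1
  unique_line : ∀ ⦃p q : P⦄, p ≠ q → ∀ ⦃ℓ m : L⦄, I p ℓ → I q ℓ → I p m → I q m → ℓ = m
  quad : ∀ ⦃p : P⦄ ⦃ℓ : L⦄, ¬ I p ℓ →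
    ∃! qM : P × L, I p qM.2 ∧ I qM.1 qM.2 ∧ I qM.1 ℓ

/-- Two points are collinear if some line is incident with both. -/
def Coll (I : P → L → Prop) (x y : P) : Prop := ∃ ℓ : L, I x ℓ ∧ I y ℓ

/-- The automorphism group of an incidence structure, as a subgroup of
`Perm P × Perm L`: pairs of permutations preserving incidence. -/
def autGroup (I : P → L → Prop) : Subgroup (Perm P × Perm L) where
  carrier := {g | ∀ p ℓ, I (g.1 p) (g.2 ℓ) ↔ I p ℓ}
  one_mem' := fun _ _ => Iff.rfl
  mul_mem' := fun {a b} ha hb p ℓ => (ha (b.1 p) (b.2 ℓ)).trans (hb p ℓ)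
  inv_mem' := by
    intro a ha p ℓ
    have h := ha (a⁻¹.1 p) (a⁻¹.2 ℓ)
    simpa using h.symm

/-- The full group `Ẽ(p)` of symmetries with center `p`: automorphisms fixing every
point collinear with `p`. -/
def symmGroup (I : P → L → Prop) (p : P) : Subgroup (Perm P × Perm L) where
  carrier := {g | g ∈ autGroup I ∧ ∀ y : P, Coll I p y → g.1 y = y}
  one_mem' := ⟨(autGroup I).one_mem, fun _ _ => rfl⟩
  mul_mem' := by
    rintro a b ⟨ha, ha'⟩ ⟨hb, hb'⟩
    refine ⟨(autGroup I).mul_mem ha hb, fun y hy => ?_⟩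
    have : (a * b).1 y = a.1 (b.1 y) := rfl
    rw [this, hb' y hy, ha' y hy]
  inv_mem' := by
    rintro a ⟨ha, ha'⟩
    refine ⟨(autGroup I).inv_mem ha, fun y hy => ?_⟩
    have h : a⁻¹.1 (a.1 y) = y := by simp
    rw [ha' y hy] at h
    exact h

/-- `x^⊥`: the set of points collinear with `x` (including `x` itself). -/
def perpSet (I : P → L → Prop) (x : P) : Set P := {y | Coll I x y}

/-- The hyperbolic line `{x,y}^{⊥⊥}`: points collinear with every point of
`{x,y}^⊥ = x^⊥ ∩ y^⊥`. -/
def hypLine (I : P → L → Prop) (x y : P) : Set P :=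
  {z | ∀ w ∈ perpSet I x ∩ perpSet I y, Coll I z w}

/-- The group `G` generated by all the point-symmetries of the quadrangle. -/
def bigGroup (I : P → L → Prop) : Subgroup (Perm P × Perm L) :=
  ⨆ x : P, symmGroup I x

/-- The set `P_r` of `r`-points: points whose full group of symmetries has order
divisible by `r`. -/
def Pr (I : P → L → Prop) (r : ℕ) : Set P :=
  {y | r ∣ Nat.card (symmGroup I y)}

/-- The set `L_r` of lines incident with at least two points of `P_r`. -/
def Lr (I : P → L → Prop) (r : ℕ) : Set L :=
  {ℓ | ∃ x y : P, x ≠ y ∧ x ∈ Pr I r ∧ y ∈ Pr I r ∧ I x ℓ ∧ I y ℓ}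

/-- The stabilizer `G_u` of a point `u` in a group `G` of automorphisms. -/
def stabPt (G : Subgroup (Perm P × Perm L)) (u : P) : Subgroup (Perm P × Perm L) where
  carrier := {g | g ∈ G ∧ g.1 u = u}
  one_mem' := ⟨G.one_mem, rfl⟩
  mul_mem' := by
    rintro a b ⟨ha, ha'⟩ ⟨hb, hb'⟩
    refine ⟨G.mul_mem ha hb, ?_⟩
    have : (a * b).1 u = a.1 (b.1 u) := rfl
    rw [this, hb', ha']
  inv_mem' := by
    rintro a ⟨ha, ha'⟩
    refine ⟨G.inv_mem ha, ?_⟩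
    have h : a⁻¹.1 (a.1 u) = u := by simp
    rw [ha'] at h
    exact h

/-- The setwise stabilizer `G_ℓ` of a line `ℓ` in a group `G` of automorphisms. -/
def stabLine (G : Subgroup (Perm P × Perm L)) (ℓ : L) : Subgroup (Perm P × Perm L) where
  carrier := {g | g ∈ G ∧ g.2 ℓ = ℓ}
  one_mem' := ⟨G.one_mem, rfl⟩
  mul_mem' := by
    rintro a b ⟨ha, ha'⟩ ⟨hb, hb'⟩
    refine ⟨G.mul_mem ha hb, ?_⟩
    have : (a * b).2 ℓ = a.2 (b.2 ℓ) := rfl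
    rw [this, hb', ha']
  inv_mem' := by
    rintro a ⟨ha, ha'⟩
    refine ⟨G.inv_mem ha, ?_⟩
    have h : a⁻¹.2 (a.2 ℓ) = ℓ := by simp
    rw [ha'] at h
    exact h

/-- Isomorphism of incidence structures: a pair of bijections between the point sets and
the line sets preserving incidence in both directions. -/
def IsoTo {P L P' L' : Type*} (I : P → L → Prop) (I' : P' → L' → Prop) : Prop :=
  ∃ (e : P ≃ P') (f : L ≃ L'), ∀ p ℓ, I' (e p) (f ℓ) ↔ I p ℓ

end GQDefs

section ClassicalGQs

/-- The standard nondegenerate alternating bilinear form on `F^4`. -/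
def sympForm {F : Type*} [Field F] (x y : Fin 4 → F) : F :=
  x 0 * y 1 - x 1 * y 0 + x 2 * y 3 - x 3 * y 2

/-- Points of `W(3,q)`: the `1`-dimensional subspaces of `F_q^4`. -/
def W3Point (F : Type*) [Field F] : Type _ :=
  {W : Submodule F (Fin 4 → F) // Module.finrank F W = 1}

/-- Lines of `W(3,q)`: the `2`-dimensional totally isotropic subspaces of `F_q^4` with
respect to a nondegenerate alternating form. -/
def W3Line (F : Type*) [Field F] : Type _ :=
  {U : Submodule F (Fin 4 → F) //
    Module.finrank F U = 2 ∧ ∀ x ∈ U, ∀ y ∈ U, sympForm x y = 0}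

/-- Incidence in `W(3,q)` is given by inclusion. -/
def W3Incid (F : Type*) [Field F] : W3Point F → W3Line F → Prop :=
  fun W U => W.1 ≤ U.1

/-- The standard nondegenerate Hermitian sesquilinear form on `F_{q²}^4`, relative to the
field automorphism `x ↦ x^q`. -/
def hermForm3 {F : Type*} [Field F] (q : ℕ) (x y : Fin 4 → F) : F :=
  x 0 * y 1 ^ q + x 1 * y 0 ^ q + x 2 * y 3 ^ q + x 3 * y 2 ^ q

/-- The standard nondegenerate Hermitian sesquilinear form on `F_{q²}^5`, relative to the
field automorphism `x ↦ x^q`. -/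
def hermForm4 {F : Type*} [Field F] (q : ℕ) (x y : Fin 5 → F) : F :=
  x 0 * y 1 ^ q + x 1 * y 0 ^ q + x 2 * y 3 ^ q + x 3 * y 2 ^ q + x 4 * y 4 ^ q

/-- Points of `H(3,q²)`: the `1`-dimensional isotropic subspaces of `F_{q²}^4`. -/
def H3Point (F : Type*) [Field F] (q : ℕ) : Type _ :=
  {W : Submodule F (Fin 4 → F) //
    Module.finrank F W = 1 ∧ ∀ x ∈ W, hermForm3 q x x = 0}

/-- Lines of `H(3,q²)`: the `2`-dimensional totally isotropic subspaces of `F_{q²}^4`. -/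
def H3Line (F : Type*) [Field F] (q : ℕ) : Type _ :=
  {U : Submodule F (Fin 4 → F) //
    Module.finrank F U = 2 ∧ ∀ x ∈ U, ∀ y ∈ U, hermForm3 q x y = 0}

/-- Incidence in `H(3,q²)` is given by inclusion. -/
def H3Incid (F : Type*) [Field F] (q : ℕ) : H3Point F q → H3Line F q → Prop :=
  fun W U => W.1 ≤ U.1

/-- Points of `H(4,q²)`: the `1`-dimensional isotropic subspaces of `F_{q²}^5`. -/
def H4Point (F : Type*) [Field F] (q : ℕ) : Type _ :=
  {W : Submodule F (Fin 5 → F) //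
    Module.finrank F W = 1 ∧ ∀ x ∈ W, hermForm4 q x x = 0}

/-- Lines of `H(4,q²)`: the `2`-dimensional totally isotropic subspaces of `F_{q²}^5`. -/
def H4Line (F : Type*) [Field F] (q : ℕ) : Type _ :=
  {U : Submodule F (Fin 5 → F) //
    Module.finrank F U = 2 ∧ ∀ x ∈ U, ∀ y ∈ U, hermForm4 q x y = 0}

/-- Incidence in `H(4,q²)` is given by inclusion. -/
def H4Incid (F : Type*) [Field F] (q : ℕ) : H4Point F q → H4Line F q → Prop :=
  fun W U => W.1 ≤ U.1

end ClassicalGQs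

section Characters

open Module

/-- The trace is additive along a short exact sequence of finite-dimensional spaces. -/
theorem trace_eq_add_of_exact {k U V Q : Type*} [Field k] [AddCommGroup U] [Module k U]
    [AddCommGroup V] [Module k V] [AddCommGroup Q] [Module k Q] [FiniteDimensional k U]
    [FiniteDimensional k V] [FiniteDimensional k Q]
    (i : U →ₗ[k] V) (q : V →ₗ[k] Q) (hi : Function.Injective i) (hq : Function.Surjective q)
    (hiq : Function.Exact i q) (fU : U →ₗ[k] U) (f : V →ₗ[k] V) (fQ : Q →ₗ[k] Q)
    (hU : f ∘ₗ i = i ∘ₗ fU) (hQ : q ∘ₗ f = fQ ∘ₗ q) :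
    LinearMap.trace k V f = LinearMap.trace k U fU + LinearMap.trace k Q fQ := by
  obtain ⟨s, hs⟩ := q.exists_rightInverse_of_surjective (LinearMap.range_eq_top.2 hq)
  have hmem : ∀ v, v - s (q v) ∈ LinearMap.range i := by
    intro v
    obtain ⟨u, hu⟩ := (hiq (v - s (q v))).1 (by
      have := LinearMap.congr_fun hs (q v)
      simp only [LinearMap.comp_apply, LinearMap.id_apply] at this
      simp [this])
    exact ⟨u, hu⟩
  let p : V →ₗ[k] U := (LinearEquiv.ofInjective i hi).symm.toLinearMap ∘ₗ
    (LinearMap.id - s ∘ₗ q).codRestrict (LinearMap.range i) hmem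
  have hp : ∀ v, i (p v) = v - s (q v) := by
    intro v
    simp [p]
  have hpi : p ∘ₗ i = LinearMap.id := by
    ext u
    apply hi
    simp [hp, hiq.apply_apply_eq_zero]
  have hid : f = (f ∘ₗ i) ∘ₗ p + (f ∘ₗ s) ∘ₗ q := by
    ext v
    simp [hp]
  conv_lhs => rw [hid]
  rw [map_add, LinearMap.trace_comp_comm' p (f ∘ₗ i), LinearMap.trace_comp_comm' q (f ∘ₗ s), hU,
    ← LinearMap.comp_assoc, hpi, LinearMap.id_comp, ← LinearMap.comp_assoc, hQ,
    LinearMap.comp_assoc, hs, LinearMap.comp_id]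

namespace Representation

/-- The character of a representation is the sum of the characters of a subrepresentation and
of the quotient by it. -/
theorem character_eq_add_quotient {k G V : Type*} [Field k] [Group G] [AddCommGroup V]
    [Module k V] [FiniteDimensional k V] (ρ : Representation k G V) (W : Submodule k V)
    (hW : ∀ g, W ≤ W.comap (ρ g)) (g : G) :
    ρ.character g = (ρ.subrepresentation W hW).character g + (ρ.quotient W hW).character g :=
  trace_eq_add_of_exact W.subtype W.mkQ W.injective_subtype W.mkQ_surjective
    (LinearMap.exact_subtype_mkQ W) _ _ _ rfl rfl

/-- The characters of the domain and codomain of an intertwining map differ by the characters of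
its kernel and cokernel. -/
theorem character_sub_eq_ker_sub_coker {k G V W : Type*} [Field k] [Group G] [AddCommGroup V]
    [Module k V] [FiniteDimensional k V] [AddCommGroup W] [Module k W] [FiniteDimensional k W]
    {ρ : Representation k G V} {σ : Representation k G W} (f : IntertwiningMap ρ σ)
    (hker : ∀ g, LinearMap.ker f.toLinearMap ≤ (LinearMap.ker f.toLinearMap).comap (ρ g))
    (hran : ∀ g, LinearMap.range f.toLinearMap ≤ (LinearMap.range f.toLinearMap).comap (σ g))
    (g : G) :
    ρ.character g - σ.character g =
      (ρ.subrepresentation _ hker).character g - (σ.quotient _ hran).character g := by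
  have h1 : ρ.character g = (ρ.subrepresentation _ hker).character g +
      (σ.subrepresentation _ hran).character g :=
    trace_eq_add_of_exact (LinearMap.ker f.toLinearMap).subtype f.toLinearMap.rangeRestrict
      (Submodule.injective_subtype _) f.toLinearMap.surjective_rangeRestrict
      (by intro v; simp [LinearMap.rangeRestrict, Subtype.ext_iff]) _ _ _ rfl
      (by ext v; exact IntertwiningMap.isIntertwining ρ σ f g v)
  rw [h1, character_eq_add_quotient σ _ hran]
  ring

/-- An element all of whose powers have the character value of the identity acts trivially. -/
theorem apply_eq_one_of_character_pow {G V : Type*} [Group G] [Finite G] [AddCommGroup V]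
    [Module ℂ V] [FiniteDimensional ℂ V] (ρ : Representation ℂ G V) (g : G)
    (h : ∀ j : ℤ, ρ.character (g ^ j) = finrank ℂ V) : ρ g = 1 := by
  classical
  have := Fintype.ofFinite G
  let τ : Representation ℂ (Subgroup.zpowers g) V := ρ.comp (Subgroup.zpowers g).subtype
  have hcard : (Nat.card (Subgroup.zpowers g) : ℂ) ≠ 0 := by
    exact_mod_cast Nat.card_pos.ne'
  have := invertibleOfNonzero hcard
  have hsum := card_inv_mul_sum_char_eq_finrank τ
  have hconst : ∀ c : Subgroup.zpowers g, τ.character c = finrank ℂ V := by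
    rintro ⟨_, j, rfl⟩
    exact h j
  simp only [hconst, Finset.sum_const, Finset.card_univ, ← Nat.card_eq_fintype_card,
    nsmul_eq_mul] at hsum
  rw [inv_mul_cancel_left₀ hcard] at hsum
  have htop : τ.invariants = ⊤ :=
    Submodule.eq_top_of_finrank_eq (by exact_mod_cast hsum.symm)
  ext v
  have hv : v ∈ τ.invariants := htop ▸ Submodule.mem_top
  exact hv ⟨g, Subgroup.mem_zpowers g⟩

/-- Every nontrivial element of a finite group acts nontrivially in some irreducible complex
representation. -/
theorem exists_isIrreducible_apply_ne_one {H : Type} [Group H] [Finite H] {h : H} (hh : h ≠ 1) :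
    ∃ (W : Type) (_ : AddCommGroup W) (_ : Module ℂ W) (_ : FiniteDimensional ℂ W)
      (σ : Representation ℂ H W), σ.IsIrreducible ∧ σ h ≠ 1 := by
  classical
  let S : ℕ → Prop := fun n => ∃ (W : Type) (_ : AddCommGroup W) (_ : Module ℂ W)
    (_ : FiniteDimensional ℂ W) (σ : Representation ℂ H W), finrank ℂ W = n ∧ σ h ≠ 1
  have hS : ∃ n, S n := by
    have hfin : FiniteDimensional ℂ (MonoidAlgebra ℂ H) :=
      Module.Finite.equiv (MonoidAlgebra.coeffLinearEquiv ℂ).symm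
    refine ⟨_, MonoidAlgebra ℂ H, inferInstance, inferInstance, hfin, leftRegular ℂ H, rfl, ?_⟩
    intro h1
    have h2 := LinearMap.congr_fun h1 (MonoidAlgebra.single 1 1)
    rw [ofMulAction_single, smul_eq_mul, mul_one] at h2
    exact hh (MonoidAlgebra.of_injective h2)
  obtain ⟨W, i1, i2, i3, σ, hn, hσ⟩ := Nat.find_spec hS
  have htriv : ∀ (U : Type) [AddCommGroup U] [Module ℂ U] [FiniteDimensional ℂ U]
      (τ : Representation ℂ H U), finrank ℂ U < finrank ℂ W →
      ∀ j : ℤ, τ.character (h ^ j) = finrank ℂ U := by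
    intro U _ _ _ τ hU j
    have : τ h = 1 := by
      by_contra hne
      exact Nat.find_min hS (hn ▸ hU) ⟨U, _, _, inferInstance, τ, rfl, hne⟩
    have hk : h ^ j ∈ MonoidHom.ker τ := Subgroup.zpow_mem _ this j
    have hk' : τ (h ^ j) = 1 := hk
    rw [character, hk', LinearMap.trace_one]
  refine ⟨W, i1, i2, i3, σ, ?_, hσ⟩
  have hnt : Nontrivial W := by
    by_contra hW
    rw [not_nontrivial_iff_subsingleton] at hW
    exact hσ (by ext v; exact Subsingleton.elim _ _)
  refine { exists_pair_ne := ⟨⊥, ⊤, ?_⟩, eq_bot_or_eq_top := ?_ }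
  · intro hbt
    have : (⊥ : Submodule ℂ W) = ⊤ := congrArg Subrepresentation.toSubmodule hbt
    exact bot_ne_top this
  · intro U
    by_contra hU
    push Not at hU
    have hb : U.toSubmodule ≠ ⊥ := fun e => hU.1 (Subrepresentation.toSubmodule_injective e)
    have ht : U.toSubmodule ≠ ⊤ := fun e => hU.2 (Subrepresentation.toSubmodule_injective e)
    have hinv : ∀ g, U.toSubmodule ≤ U.toSubmodule.comap (σ g) :=
      fun g v hv => U.apply_mem_toSubmodule g hv
    have hadd := U.toSubmodule.finrank_quotient_add_finrank
    have hpos : 0 < finrank ℂ U.toSubmodule :=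
      finrank_pos_iff.2 (Submodule.nontrivial_iff_ne_bot.2 hb)
    have hlt : finrank ℂ U.toSubmodule < finrank ℂ W := Submodule.finrank_lt ht
    refine hσ (apply_eq_one_of_character_pow σ h fun j => ?_)
    rw [character_eq_add_quotient σ _ hinv, htriv _ _ hlt, htriv _ _ (by omega), ← hadd]
    push_cast
    ring

/-- A difference of two characters which has norm one is, up to sign, a character. -/
theorem exists_character_of_norm_eq_one {G : Type} [Group G] [Fintype G] (n : ℕ) :
    ∀ (A B : Type) [AddCommGroup A] [Module ℂ A] [FiniteDimensional ℂ A]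
      [AddCommGroup B] [Module ℂ B] [FiniteDimensional ℂ B]
      (ρ : Representation ℂ G A) (σ : Representation ℂ G B), finrank ℂ B = n →
      (∑ g : G, (ρ.character g - σ.character g) * (ρ.character g⁻¹ - σ.character g⁻¹) =
        Nat.card G) →
      ∃ (V : Type) (_ : AddCommGroup V) (_ : Module ℂ V) (_ : FiniteDimensional ℂ V)
        (τ : Representation ℂ G V), (∀ g, ρ.character g - σ.character g = τ.character g) ∨
          (∀ g, σ.character g - ρ.character g = τ.character g) := by
  induction n using Nat.strong_induction_on with
  | _ n ih =>
  intro A B _ _ _ _ _ _ ρ σ hn hsum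
  by_cases hf : ∃ f : IntertwiningMap ρ σ, f ≠ 0
  · obtain ⟨f, hf⟩ := hf
    have hker : ∀ g, LinearMap.ker f.toLinearMap ≤ (LinearMap.ker f.toLinearMap).comap (ρ g) :=
      fun g v hv => f.ker.apply_mem_toSubmodule g hv
    have hran : ∀ g, LinearMap.range f.toLinearMap ≤
        (LinearMap.range f.toLinearMap).comap (σ g) :=
      fun g v hv => f.range.apply_mem_toSubmodule g hv
    have hlt : finrank ℂ (B ⧸ LinearMap.range f.toLinearMap) < n := by
      have hadd := (LinearMap.range f.toLinearMap).finrank_quotient_add_finrank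
      have hpos : 0 < finrank ℂ (LinearMap.range f.toLinearMap) := by
        refine finrank_pos_iff.2 (Submodule.nontrivial_iff_ne_bot.2 fun hbot => hf ?_)
        exact IntertwiningMap.ext (LinearMap.range_eq_bot.1 hbot)
      omega
    have hdiff := character_sub_eq_ker_sub_coker f hker hran
    simp only [hdiff] at hsum
    obtain ⟨V, i1, i2, i3, τ, hτ⟩ := ih _ hlt _ _ _ _ rfl hsum
    refine ⟨V, i1, i2, i3, τ, ?_⟩
    rcases hτ with hτ | hτ
    · exact Or.inl fun g => (hdiff g).trans (hτ g)
    · exact Or.inr fun g => by rw [← hτ g, ← neg_sub, hdiff g, neg_sub]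
  · push Not at hf
    have hcard : (Nat.card G : ℂ) ≠ 0 := by exact_mod_cast Nat.card_pos.ne'
    have := invertibleOfNonzero hcard
    have hsub : Subsingleton (IntertwiningMap ρ σ) :=
      ⟨fun f f' => (hf f).trans (hf f').symm⟩
    have h0 := card_inv_mul_sum_char_mul_char_eq_finrank ρ σ
    have hA := card_inv_mul_sum_char_mul_char_eq_finrank ρ ρ
    have hB := card_inv_mul_sum_char_mul_char_eq_finrank σ σ
    have h0' : ∑ g : G, ρ.character g * σ.character g⁻¹ =
        ∑ g : G, σ.character g * ρ.character g⁻¹ :=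
      Fintype.sum_equiv (Equiv.inv G) _ _ fun g => by simp [mul_comm]
    rw [finrank_zero_of_subsingleton] at h0
    rw [Nat.cast_zero, mul_eq_zero, or_iff_right (inv_ne_zero hcard)] at h0
    rw [inv_mul_eq_iff_eq_mul₀ hcard] at hA hB
    have hone : (finrank ℂ (IntertwiningMap ρ ρ) : ℂ) + finrank ℂ (IntertwiningMap σ σ) = 1 := by
      apply mul_left_cancel₀ hcard
      rw [mul_add, ← hA, ← hB, mul_one, ← hsum]
      have hexp : ∀ g, (ρ.character g - σ.character g) * (ρ.character g⁻¹ - σ.character g⁻¹) =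
          ρ.character g * ρ.character g⁻¹ + σ.character g * σ.character g⁻¹ -
            ρ.character g * σ.character g⁻¹ - σ.character g * ρ.character g⁻¹ :=
        fun g => by ring
      simp only [hexp, Finset.sum_sub_distrib, Finset.sum_add_distrib, h0', h0, sub_zero]
    have hone' : finrank ℂ (IntertwiningMap ρ ρ) + finrank ℂ (IntertwiningMap σ σ) = 1 := by
      exact_mod_cast hone
    have hzero : ∀ (U : Type) [AddCommGroup U] [Module ℂ U] [FiniteDimensional ℂ U]
        (τ : Representation ℂ G U), finrank ℂ (IntertwiningMap τ τ) = 0 →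
        ∀ g, τ.character g = 0 := by
      intro U _ _ _ τ hτ g
      have : FiniteDimensional ℂ (IntertwiningMap τ τ) :=
        Module.Finite.equiv (invariantsEquivIntertwiningMap τ τ)
      have hs : Subsingleton (IntertwiningMap τ τ) := finrank_zero_iff.1 hτ
      have hid : LinearMap.id (R := ℂ) (M := U) = 0 :=
        congrArg IntertwiningMap.toLinearMap (Subsingleton.elim (IntertwiningMap.id τ) 0)
      have : τ g = 0 := by
        rw [← LinearMap.comp_id (τ g), hid, LinearMap.comp_zero]
      rw [character, this, map_zero]
    rcases Nat.add_eq_one_iff.1 hone' with ⟨h, -⟩ | ⟨-, h⟩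
    · exact ⟨B, _, _, inferInstance, σ, Or.inr fun g => by rw [hzero A ρ h, sub_zero]⟩
    · exact ⟨A, _, _, inferInstance, ρ, Or.inl fun g => by rw [hzero B σ h, sub_zero]⟩

end Representation

end Characters

section Frobenius

open Module MulAction

/-- The trace of an endomorphism of a finite power of a space is the sum of the traces of its
diagonal blocks. -/
theorem trace_pi_eq_sum {k Ω W : Type*} [Field k] [Fintype Ω] [DecidableEq Ω] [AddCommGroup W]
    [Module k W] [FiniteDimensional k W] (f : (Ω → W) →ₗ[k] (Ω → W)) :
    LinearMap.trace k (Ω → W) f = ∑ ω, LinearMap.trace k W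
      (LinearMap.proj ω ∘ₗ f ∘ₗ LinearMap.single k (fun _ => W) ω) := by
  have hf : f = ∑ ω, (f ∘ₗ LinearMap.single k (fun _ => W) ω) ∘ₗ LinearMap.proj ω := by
    ext ω w : 2
    simp only [LinearMap.comp_apply, LinearMap.sum_apply, LinearMap.proj_apply]
    rw [← map_sum]
    congr 1
    exact (LinearMap.sum_single_apply _ _).symm
  conv_lhs => rw [hf]
  rw [map_sum]
  exact Finset.sum_congr rfl fun ω _ => LinearMap.trace_comp_comm' _ _

namespace Representation

/-- The representation on `W`-valued functions obtained by twisting the permutation action by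
a cocycle with values in a group acting on `W`. -/
def twisted {k G H Ω W : Type*} [Field k] [Group G] [Group H] [MulAction G Ω] [AddCommGroup W]
    [Module k W] (c : G → Ω → H) (hone : ∀ ω, c 1 ω = 1)
    (hmul : ∀ g g' ω, c (g * g') ω = c g (g' • ω) * c g' ω) (σ : Representation k H W) :
    Representation k G (Ω → W) where
  toFun g := LinearMap.pi fun ω => σ (c g (g⁻¹ • ω)) ∘ₗ LinearMap.proj (g⁻¹ • ω)
  map_one' := by
    ext f ω
    simp [hone]
  map_mul' g g' := by
    apply LinearMap.ext
    intro f
    funext ω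
    simp [hmul, mul_smul]

theorem twisted_character {k G H Ω W : Type*} [Field k] [Group G] [Group H] [MulAction G Ω]
    [Fintype Ω] [DecidableEq Ω] [AddCommGroup W] [Module k W] [FiniteDimensional k W]
    (c : G → Ω → H) (hone : ∀ ω, c 1 ω = 1)
    (hmul : ∀ g g' ω, c (g * g') ω = c g (g' • ω) * c g' ω) (σ : Representation k H W) (g : G) :
    (twisted c hone hmul σ).character g =
      ∑ ω, if g • ω = ω then σ.character (c g ω) else 0 := by
  rw [character, trace_pi_eq_sum]
  refine Finset.sum_congr rfl fun ω _ => ?_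
  split_ifs with h
  · have h' : g⁻¹ • ω = ω := inv_smul_eq_iff.2 h.symm
    rw [character]
    congr 1
    ext w
    simp [twisted, h']
  · have h' : g⁻¹ • ω ≠ ω := fun e => h (inv_smul_eq_iff.1 e).symm
    rw [← map_zero (LinearMap.trace k W)]
    congr 1
    ext w
    simp [twisted, h']

theorem prod_character {k G V W : Type*} [Field k] [Group G] [AddCommGroup V] [Module k V]
    [FiniteDimensional k V] [AddCommGroup W] [Module k W] [FiniteDimensional k W]
    (ρ : Representation k G V) (σ : Representation k G W) (g : G) :
    (ρ.prod σ).character g = ρ.character g + σ.character g :=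
  LinearMap.trace_prodMap' (ρ g) (σ g)

end Representation

/-- The elements of `G` that are trivial or act without fixed points. -/
def frobeniusKernelSet (G Ω : Type*) [Group G] [MulAction G Ω] : Set G :=
  {g | g = 1 ∨ ∀ ω : Ω, g • ω ≠ ω}

/-- A transitive action carries a cocycle with values in a point stabilizer which, at fixed
points, is given by conjugation. -/
theorem exists_cocycle_stabilizer {G Ω : Type*} [Group G] [MulAction G Ω] [IsPretransitive G Ω]
    (x : Ω) : ∃ c : G → Ω → stabilizer G x, (∀ ω, c 1 ω = 1) ∧
      (∀ g g' ω, c (g * g') ω = c g (g' • ω) * c g' ω) ∧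
      ∀ ω, ∃ a : G, a • x = ω ∧ ∀ g, g • ω = ω → (c g ω : G) = a⁻¹ * g * a := by
  choose a ha using fun ω : Ω => exists_smul_eq G x ω
  refine ⟨fun g ω => ⟨(a (g • ω))⁻¹ * g * a ω, ?_⟩, fun ω => ?_, fun g g' ω => ?_, fun ω => ?_⟩
  · rw [mem_stabilizer_iff, mul_smul, mul_smul, ha, inv_smul_eq_iff, ha]
  · simp
  · ext
    simp [mul_smul, mul_assoc]
  · exact ⟨a ω, ha ω, fun g hg => by simp [hg]⟩

theorem sum_fixed_cocycle {G Ω M : Type*} [Group G] [Fintype G] [MulAction G Ω]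
    [Fintype Ω] [DecidableEq Ω] [AddCommMonoid M] (x : Ω) [Fintype (stabilizer G x)]
    (c : G → Ω → stabilizer G x)
    (hc : ∀ ω, ∃ a : G, a • x = ω ∧ ∀ g, g • ω = ω → (c g ω : G) = a⁻¹ * g * a)
    (F : stabilizer G x → M) :
    ∑ g : G, ∑ ω : Ω, (if g • ω = ω then F (c g ω) else 0) =
      Fintype.card Ω • ∑ h, F h := by
  rw [Finset.sum_comm, ← Finset.card_univ, ← Finset.sum_const]
  refine Finset.sum_congr rfl fun ω _ => ?_
  obtain ⟨a, rfl, hcon⟩ := hc ω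
  rw [← Finset.sum_filter]
  refine Finset.sum_bij' (fun g _ => c g (a • x)) (fun h _ => a * h * a⁻¹) ?_ ?_ ?_ ?_ ?_
  · simp
  · intro h _
    have := h.2
    rw [mem_stabilizer_iff] at this
    simp [mul_smul, this]
  · intro g hg
    rw [hcon g (Finset.mem_filter.1 hg).2]
    group
  · intro h _
    have := h.2
    rw [mem_stabilizer_iff] at this
    ext
    rw [hcon _ (by simp [mul_smul, this])]
    group
  · intros
    rfl

/-- For every irreducible representation `σ` of a point stabilizer of a Frobenius action there
is a representation of the whole group, trivial on fixed-point-free elements, whose character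
extends that of `σ`. -/
theorem exists_frobenius_extension {G Ω : Type} [Group G] [Finite G] [MulAction G Ω] [Finite Ω]
    [IsPretransitive G Ω] (hfix : ∀ g : G, g ≠ 1 → ∀ u v : Ω, g • u = u → g • v = v → u = v) (x : Ω)
    (c : G → Ω → stabilizer G x) (hone : ∀ ω, c 1 ω = 1)
    (hmul : ∀ g g' ω, c (g * g') ω = c g (g' • ω) * c g' ω)
    (hc : ∀ ω, ∃ a : G, a • x = ω ∧ ∀ g, g • ω = ω → (c g ω : G) = a⁻¹ * g * a)
    {W : Type} [AddCommGroup W] [Module ℂ W] [FiniteDimensional ℂ W]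
    (σ : Representation ℂ (stabilizer G x) W) (hσ : σ.IsIrreducible) :
    ∃ (V : Type) (_ : AddCommGroup V) (_ : Module ℂ V) (_ : FiniteDimensional ℂ V)
      (τ : Representation ℂ G V), finrank ℂ V = finrank ℂ W ∧
      (∀ g, (∀ ω : Ω, g • ω ≠ ω) → τ.character g = finrank ℂ W) ∧
      ∀ g ω, g • ω = ω → τ.character g = σ.character (c g ω) := by
  classical
  have := Fintype.ofFinite G
  have := Fintype.ofFinite Ω
  have := Fintype.ofFinite (stabilizer G x)
  have hW : Nontrivial W := by
    by_contra h
    rw [not_nontrivial_iff_subsingleton] at h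
    obtain ⟨p, q, hpq⟩ := hσ.exists_pair_ne
    exact hpq (Subrepresentation.toSubmodule_injective (Subsingleton.elim _ _))
  set k : ℂ := (finrank ℂ W : ℂ) with hk
  have hkpos : 0 < finrank ℂ W := finrank_pos
  let ρA := (Representation.twisted c hone hmul σ).prod (Representation.trivial ℂ G W)
  let ρB := Representation.twisted c hone hmul (Representation.trivial ℂ (stabilizer G x) W)
  have htriv : ∀ (K : Type) [Group K] (g : K), (Representation.trivial ℂ K W).character g = k := by
    intro K _ g
    exact LinearMap.trace_one ℂ W
  have hφ : ∀ g, ρA.character g - ρB.character g =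
      k + ∑ ω : Ω, if g • ω = ω then σ.character (c g ω) - k else 0 := by
    intro g
    simp only [ρA, ρB, Representation.prod_character, Representation.twisted_character, htriv]
    rw [add_comm, add_sub_assoc, ← Finset.sum_sub_distrib]
    congr 1
    refine Finset.sum_congr rfl fun ω _ => ?_
    split_ifs <;> simp
  have hφfix : ∀ g ω, g • ω = ω →
      ρA.character g - ρB.character g = σ.character (c g ω) := by
    intro g ω hg
    rw [hφ]
    by_cases h1 : g = 1
    · subst h1
      simp [hone, hk]
    · have : ∀ ω', g • ω' = ω' ↔ ω' = ω :=
        fun ω' => ⟨fun h => hfix g h1 _ _ h hg, fun h => h ▸ hg⟩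
      simp [this]
  have hφfree : ∀ g, (∀ ω : Ω, g • ω ≠ ω) → ρA.character g - ρB.character g = k := by
    intro g hg
    simp [hφ, hg]
  have hcinv : ∀ g ω, g • ω = ω → c g⁻¹ ω = (c g ω)⁻¹ := by
    intro g ω hg
    have := hmul g⁻¹ g ω
    rw [inv_mul_cancel, hone, hg] at this
    exact eq_inv_of_mul_eq_one_left this.symm
  have hprod : ∀ g, (ρA.character g - ρB.character g) * (ρA.character g⁻¹ - ρB.character g⁻¹) =
      k ^ 2 + ∑ ω : Ω, if g • ω = ω then
        σ.character (c g ω) * σ.character (c g ω)⁻¹ - k ^ 2 else 0 := by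
    intro g
    by_cases hg : ∃ ω : Ω, g • ω = ω
    · obtain ⟨ω, hω⟩ := hg
      rw [hφfix g ω hω, hφfix g⁻¹ ω (inv_smul_eq_iff.2 hω.symm), hcinv g ω hω]
      by_cases h1 : g = 1
      · subst h1
        simp [hone, hk, sq]
      · have : ∀ ω', g • ω' = ω' ↔ ω' = ω :=
          fun ω' => ⟨fun h => hfix g h1 _ _ h hω, fun h => h ▸ hω⟩
        simp [this]
    · push Not at hg
      rw [hφfree g hg, hφfree g⁻¹ fun ω h => hg ω (inv_smul_eq_iff.1 h).symm]
      simp [hg, sq]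
  have hcardH : (Nat.card (stabilizer G x) : ℂ) ≠ 0 := by exact_mod_cast Nat.card_pos.ne'
  have hnorm : ∑ h : stabilizer G x, σ.character h * σ.character h⁻¹ =
      Nat.card (stabilizer G x) := by
    have := invertibleOfNonzero hcardH
    have h := Representation.char_orthonormal σ σ
    rw [if_pos ⟨Representation.Equiv.refl σ⟩, inv_mul_eq_iff_eq_mul₀ hcardH, mul_one] at h
    exact h
  have hcard : Fintype.card Ω * Nat.card (stabilizer G x) = Nat.card G := by
    have h := index_stabilizer_of_transitive G x
    rw [← Nat.card_eq_fintype_card, ← h, mul_comm]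
    exact (stabilizer G x).card_mul_index
  have hsum : ∑ g : G, (ρA.character g - ρB.character g) *
      (ρA.character g⁻¹ - ρB.character g⁻¹) = Nat.card G := by
    simp only [hprod]
    rw [Finset.sum_add_distrib,
      sum_fixed_cocycle x c hc (fun h => σ.character h * σ.character h⁻¹ - k ^ 2),
      Finset.sum_sub_distrib, hnorm]
    simp only [Finset.sum_const, Finset.card_univ, ← Nat.card_eq_fintype_card (α := G),
      ← Nat.card_eq_fintype_card (α := stabilizer G x), nsmul_eq_mul, ← hcard]
    push_cast
    ring
  obtain ⟨V, i1, i2, i3, τ, hτ⟩ :=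
    Representation.exists_character_of_norm_eq_one _ _ _ ρA ρB rfl hsum
  have hφ1 : ρA.character 1 - ρB.character 1 = k := by
    rw [hφfix 1 x (one_smul _ _), hone, Representation.char_one]
  have hplus : ∀ g, ρA.character g - ρB.character g = τ.character g := by
    rcases hτ with h | h
    · exact h
    · have h1 := h 1
      rw [← neg_sub, hφ1, Representation.char_one, hk, neg_eq_iff_add_eq_zero] at h1
      norm_cast at h1
      omega
  refine ⟨V, i1, i2, i3, τ, ?_, fun g hg => ?_, fun g ω hg => ?_⟩
  · have h1 := hplus 1
    rw [hφ1, Representation.char_one, hk] at h1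
    exact_mod_cast h1.symm
  · rw [← hplus, hφfree g hg]
  · rw [← hplus, hφfix g ω hg]

/-- **Frobenius' theorem**: in a Frobenius action, the elements that are trivial or fixed-point
free are closed under multiplication. -/
theorem mul_mem_frobeniusKernelSet {G Ω : Type} [Group G] [Finite G] [MulAction G Ω] [Finite Ω]
    [IsPretransitive G Ω] (hfix : ∀ g : G, g ≠ 1 → ∀ u v : Ω, g • u = u → g • v = v → u = v)
    {g₁ g₂ : G} (h₁ : g₁ ∈ frobeniusKernelSet G Ω) (h₂ : g₂ ∈ frobeniusKernelSet G Ω) :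
    g₁ * g₂ ∈ frobeniusKernelSet G Ω := by
  by_contra hnot
  simp only [frobeniusKernelSet, Set.mem_ofPred_eq, not_or, not_forall, not_not] at hnot
  obtain ⟨hne, ω, hω⟩ := hnot
  obtain ⟨c, hone, hmul, hc⟩ := exists_cocycle_stabilizer (G := G) ω
  obtain ⟨a, -, hcon⟩ := hc ω
  have hcne : c (g₁ * g₂) ω ≠ 1 := by
    intro h
    have h' := hcon _ hω
    rw [h, OneMemClass.coe_one, mul_assoc, eq_comm, inv_mul_eq_iff_eq_mul, mul_one,
      mul_eq_right] at h'
    exact hne h'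
  obtain ⟨W, i1, i2, i3, σ, hirr, hσ⟩ := Representation.exists_isIrreducible_apply_ne_one hcne
  obtain ⟨V, j1, j2, j3, τ, hdim, hfree, hfixed⟩ :=
    exists_frobenius_extension hfix ω c hone hmul hc σ hirr
  have hker : ∀ g ∈ frobeniusKernelSet G Ω, τ g = 1 := by
    rintro g (rfl | hg)
    · exact map_one τ
    · refine Representation.apply_eq_one_of_character_pow τ g fun j => ?_
      by_cases hj : g ^ j = 1
      · rw [hj, Representation.char_one]
      · rw [hdim]
        refine hfree _ fun u hu => hg u (hfix _ hj _ _ ?_ hu)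
        rw [← mul_smul, ← zpow_add_one, add_comm, zpow_add, zpow_one, mul_smul, hu]
  have hτ : τ (g₁ * g₂) = 1 := by rw [map_mul, hker _ h₁, hker _ h₂, mul_one]
  refine hσ (Representation.apply_eq_one_of_character_pow σ _ fun j => ?_)
  have hfixj : (g₁ * g₂) ^ j • ω = ω := by
    have : (g₁ * g₂) ^ j ∈ stabilizer G ω := Subgroup.zpow_mem _ hω j
    exact this
  have hcj : c ((g₁ * g₂) ^ j) ω = c (g₁ * g₂) ω ^ j := by
    ext
    rw [hcon _ hfixj, Subgroup.coe_zpow, hcon _ hω]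
    have := conj_zpow (i := j) (a := a⁻¹) (b := g₁ * g₂)
    rw [inv_inv] at this
    exact this.symm
  have hτj : (g₁ * g₂) ^ j ∈ MonoidHom.ker τ := Subgroup.zpow_mem _ hτ j
  have hτj' : τ ((g₁ * g₂) ^ j) = 1 := hτj
  rw [← hcj, ← hfixed _ _ hfixj, Representation.character, hτj', LinearMap.trace_one, hdim]

/-- The Frobenius kernel of a Frobenius action. -/
def frobeniusKernel {G Ω : Type} [Group G] [Finite G] [MulAction G Ω] [Finite Ω]
    [IsPretransitive G Ω] (hfix : ∀ g : G, g ≠ 1 → ∀ u v : Ω, g • u = u → g • v = v → u = v) :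
    Subgroup G where
  carrier := frobeniusKernelSet G Ω
  one_mem' := Or.inl rfl
  mul_mem' := mul_mem_frobeniusKernelSet hfix
  inv_mem' := by
    rintro g (rfl | hg)
    · exact Or.inl inv_one
    · exact Or.inr fun ω h => hg ω (inv_smul_eq_iff.1 h).symm

theorem conj_mem_frobeniusKernelSet {G Ω : Type*} [Group G] [MulAction G Ω] {g : G}
    (hg : g ∈ frobeniusKernelSet G Ω) (a : G) : a * g * a⁻¹ ∈ frobeniusKernelSet G Ω := by
  rcases hg with rfl | hg
  · left
    simp
  · refine Or.inr fun ω h => hg (a⁻¹ • ω) ?_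
    rw [mul_smul, mul_smul, ← eq_inv_smul_iff] at h
    exact h

/-- The Frobenius kernel acts transitively. -/
theorem exists_mem_frobeniusKernelSet_smul_eq {G Ω : Type} [Group G] [Finite G] [MulAction G Ω]
    [Finite Ω] [IsPretransitive G Ω]
    (hfix : ∀ g : G, g ≠ 1 → ∀ u v : Ω, g • u = u → g • v = v → u = v) (x y : Ω) :
    ∃ g ∈ frobeniusKernelSet G Ω, g • x = y := by
  classical
  have := Fintype.ofFinite G
  have := Fintype.ofFinite Ω
  let N := frobeniusKernel hfix
  have hinj : Function.Injective fun g : N => (g : G) • x := by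
    intro g g' h
    have hx : ((g'⁻¹ * g : N) : G) • x = x := by
      simp only [Subgroup.coe_mul, Subgroup.coe_inv, mul_smul]
      rw [inv_smul_eq_iff]
      exact h
    rcases (g'⁻¹ * g).2 with h1 | h1
    · exact (inv_mul_eq_one.1 (Subtype.ext h1)).symm
    · exact absurd hx (h1 x)
  have hburn := sum_card_fixedBy_eq_card_orbits_mul_card_group G Ω
  have horb : Fintype.card (Quotient (orbitRel G Ω)) = 1 := by
    have := (pretransitive_iff_subsingleton_quotient G Ω).1 inferInstance
    rw [Fintype.card_eq_one_iff_nonempty_unique]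
    exact ⟨uniqueOfSubsingleton (Quotient.mk _ x)⟩
  have hcount : ∀ g : G, Fintype.card (fixedBy Ω g) + (if g ∈ N then 1 else 0) =
      1 + if g = 1 then Fintype.card Ω else 0 := by
    intro g
    by_cases h1 : g = 1
    · subst h1
      simp [add_comm]
    · by_cases hg : g ∈ N
      · have hfree := hg.resolve_left h1
        have : IsEmpty (fixedBy Ω g) := ⟨fun ω => hfree ω ω.2⟩
        simp [h1, hg]
      · have : ∃ ω : Ω, g • ω = ω := by
          by_contra h
          push Not at h
          exact hg (Or.inr h)
        obtain ⟨ω, hω⟩ := this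
        have : Fintype.card (fixedBy Ω g) = 1 :=
          Fintype.card_eq_one_iff.2 ⟨⟨ω, hω⟩, fun u => Subtype.ext (hfix g h1 _ _ u.2 hω)⟩
        simp [h1, hg, this]
  have hsum := Finset.sum_congr (s₁ := (Finset.univ : Finset G)) rfl fun g _ => hcount g
  rw [Finset.sum_add_distrib, Finset.sum_add_distrib, hburn, horb] at hsum
  have hcardN : Fintype.card N = Fintype.card Ω := by
    rw [Fintype.card_subtype]
    simpa using hsum
  obtain ⟨g, hg⟩ := ((Fintype.bijective_iff_injective_and_card _).2 ⟨hinj, hcardN⟩).2 y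
  exact ⟨g, g.2, hg⟩

end Frobenius

section FrobeniusOrbits

open MulAction

theorem orbit_fixed_unique {G X : Type*} [Group G] [MulAction G X]
    (hfix : ∀ g : G, g ≠ 1 → ∀ u v : X, g • u = u → g • v = v → u = v) (x : X) :
    ∀ g : G, g ≠ 1 → ∀ u v : orbit G x, g • u = u → g • v = v → u = v :=
  fun g hg u v hu hv =>
    Subtype.ext (hfix g hg u v (congrArg Subtype.val hu) (congrArg Subtype.val hv))

theorem exists_fixed_of_notMem_frobeniusKernelSet {G X : Type*} [Group G] [MulAction G X]
    {x : X} {g : G} (hg : g ∉ frobeniusKernelSet G (orbit G x)) :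
    ∃ u ∈ orbit G x, g • u = u := by
  simp only [frobeniusKernelSet, Set.mem_ofPred_eq, not_or, not_forall, not_not] at hg
  obtain ⟨-, u, hu⟩ := hg
  exact ⟨u, u.2, congrArg Subtype.val hu⟩

theorem eq_one_of_mem_frobeniusKernelSet {G X : Type*} [Group G] [MulAction G X] {x u : X}
    (hu : u ∈ orbit G x) {g : G} (hg : g ∈ frobeniusKernelSet G (orbit G x)) (hgu : g • u = u) :
    g = 1 :=
  hg.resolve_right fun h => h ⟨u, hu⟩ (Subtype.ext hgu)

/-- Suppose nontrivial elements of `G` fix at most one point, and let `E` be a `G`-equivariant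
family of subgroups of the point stabilizers. Then the product of nontrivial elements of coprime
orders from two different members of the family lies in a member of the family. -/
theorem exists_mul_mem_of_coprime {G X : Type} [Group G] [Finite G] [MulAction G X] [Finite X]
    (hfix : ∀ g : G, g ≠ 1 → ∀ u v : X, g • u = u → g • v = v → u = v)
    (E : X → Subgroup G) (hE : ∀ u, ∀ e ∈ E u, e • u = u)
    (hconj : ∀ (g : G) (u : X), ∀ e ∈ E u, g * e * g⁻¹ ∈ E (g • u))
    {x y : X} {a b : G} (ha : a ∈ E x) (hb : b ∈ E y) (ha1 : a ≠ 1) (hb1 : b ≠ 1)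
    (hcop : (orderOf a).Coprime (orderOf b)) : ∃ w, a * b ∈ E w := by
  have hfx := orbit_fixed_unique hfix x
  have hfy := orbit_fixed_unique hfix y
  let K := frobeniusKernel hfx
  by_cases hy : y ∈ orbit G x
  · obtain ⟨k, hk, hkx⟩ := exists_mem_frobeniusKernelSet_smul_eq hfx ⟨x, mem_orbit_self x⟩ ⟨y, hy⟩
    have hkK : k ∈ K := hk
    replace hkx : k • x = y := congrArg Subtype.val hkx
    have hKconj : ∀ g ∈ K, ∀ c, c * g * c⁻¹ ∈ K := fun g hg c => conj_mem_frobeniusKernelSet hg c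
    have hb' : k⁻¹ * b * k ∈ E x := by
      have := hconj k⁻¹ y b hb
      rwa [inv_inv, inv_smul_eq_iff.2 hkx.symm] at this
    set b' := k⁻¹ * b * k with hb'def
    have hcE : a * b' ∈ E x := (E x).mul_mem ha hb'
    have hc1 : a * b' ≠ 1 := by
      intro h
      have hord : orderOf b' = orderOf b := by
        have := orderOf_injective (MulAut.conj k⁻¹).toMonoidHom (MulAut.conj k⁻¹).injective b
        simpa [hb'def] using this
      rw [← hord, ← inv_eq_of_mul_eq_one_right h, orderOf_inv, Nat.coprime_self,
        orderOf_eq_one_iff] at hcop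
      exact ha1 hcop
    have hsplit : ∃ k₂ ∈ K, a * b = a * b' * k₂ := by
      refine ⟨b'⁻¹ * k * b' * k⁻¹, K.mul_mem ?_ (K.inv_mem hkK), ?_⟩
      · simpa using hKconj k hkK b'⁻¹
      · rw [hb'def]
        group
    obtain ⟨k₂, hk₂, hab⟩ := hsplit
    have hnotK : a * b ∉ K := by
      intro h
      have : a * b' ∈ K := by
        have := K.mul_mem h (K.inv_mem hk₂)
        rwa [hab, mul_inv_cancel_right] at this
      exact hc1 (eq_one_of_mem_frobeniusKernelSet (mem_orbit_self x) this (hE x _ hcE))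
    obtain ⟨w, hw, hwfix⟩ := exists_fixed_of_notMem_frobeniusKernelSet hnotK
    obtain ⟨k', hk', hk'x⟩ :=
      exists_mem_frobeniusKernelSet_smul_eq hfx ⟨x, mem_orbit_self x⟩ ⟨w, hw⟩
    have hk'K : k' ∈ K := hk'
    replace hk'x : k' • x = w := congrArg Subtype.val hk'x
    refine ⟨w, ?_⟩
    have hk₃ : (a * b')⁻¹ * (k'⁻¹ * (a * b) * k') ∈ K := by
      have h1 : (a * b')⁻¹ * k'⁻¹ * (a * b') ∈ K := by
        simpa using hKconj _ (K.inv_mem hk'K) (a * b')⁻¹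
      have h2 := K.mul_mem h1 (K.mul_mem hk₂ hk'K)
      rw [hab]
      simpa [mul_assoc] using h2
    have hfixx : ((a * b')⁻¹ * (k'⁻¹ * (a * b) * k')) • x = x := by
      rw [mul_smul, inv_smul_eq_iff, hE x _ hcE, mul_smul, mul_smul, hk'x, hwfix, ← hk'x,
        inv_smul_smul]
    have h1 := eq_one_of_mem_frobeniusKernelSet (mem_orbit_self x) hk₃ hfixx
    rw [inv_mul_eq_one] at h1
    have h2 := hconj k' x _ hcE
    rw [hk'x, h1] at h2
    simpa [mul_assoc] using h2
  · exfalso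
    have hdisj : ∀ u ∈ orbit G x, u ∉ orbit G y := fun u hu hu' =>
      hy ((orbit_eq_iff.2 hu).subst (motive := fun S => y ∈ S)
        ((orbit_eq_iff.2 hu').symm.subst (motive := fun S => y ∈ S) (mem_orbit_self y)))
    let K' := frobeniusKernel hfy
    have hbK : b ∈ K := Or.inr fun u hu => hdisj u u.2 <| by
      rw [hfix b hb1 u y (congrArg Subtype.val hu) (hE y b hb)]
      exact mem_orbit_self y
    have haK' : a ∈ K' := Or.inr fun u hu => hdisj x (mem_orbit_self x) <| by
      rw [hfix a ha1 x u (hE x a ha) (congrArg Subtype.val hu)]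
      exact u.2
    have haK : a ∉ K := fun h =>
      ha1 (eq_one_of_mem_frobeniusKernelSet (mem_orbit_self x) h (hE x a ha))
    have hbK' : b ∉ K' := fun h =>
      hb1 (eq_one_of_mem_frobeniusKernelSet (mem_orbit_self y) h (hE y b hb))
    have habK : a * b ∉ K := fun h => haK ((K.mul_mem_cancel_right hbK).1 h)
    have habK' : a * b ∉ K' := fun h => hbK' ((K'.mul_mem_cancel_left haK').1 h)
    obtain ⟨u, hu, hufix⟩ := exists_fixed_of_notMem_frobeniusKernelSet habK
    obtain ⟨v, hv, hvfix⟩ := exists_fixed_of_notMem_frobeniusKernelSet habK'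
    refine hdisj u hu ?_
    rw [hfix (a * b) (fun h => habK (h ▸ K.one_mem)) u v hufix hvfix]
    exact hv

end FrobeniusOrbits

section Quadrangle

variable {P L : Type*} {I : P → L → Prop} {s t : ℕ}

theorem Coll.symm {p q : P} (h : Coll I p q) : Coll I q p := by
  obtain ⟨ℓ, hp, hq⟩ := h
  exact ⟨ℓ, hq, hp⟩

theorem Coll.map {g : Perm P × Perm L} (hg : g ∈ autGroup I) {p q : P} (h : Coll I p q) :
    Coll I (g.1 p) (g.1 q) := by
  obtain ⟨ℓ, hp, hq⟩ := h
  exact ⟨g.2 ℓ, (hg p ℓ).2 hp, (hg q ℓ).2 hq⟩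

namespace IsGQ

theorem eq_of_coll (h : IsGQ I s t) {r p q : P} {ℓ : L} (hr : ¬ I r ℓ) (hp : I p ℓ) (hq : I q ℓ)
    (hrp : Coll I r p) (hrq : Coll I r q) : p = q := by
  obtain ⟨m, hrm, hpm⟩ := hrp
  obtain ⟨m', hrm', hqm'⟩ := hrq
  exact congrArg Prod.fst ((h.quad hr).unique (y₁ := (p, m)) (y₂ := (q, m'))
    ⟨hrm, hpm, hp⟩ ⟨hrm', hqm', hq⟩)

theorem exists_coll_on_line (h : IsGQ I s t) (p : P) (ℓ : L) : ∃ q, I q ℓ ∧ Coll I p q := by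
  by_cases hp : I p ℓ
  · exact ⟨p, hp, ℓ, hp, hp⟩
  · obtain ⟨⟨q, m⟩, ⟨hpm, hqm, hq⟩, -⟩ := h.quad hp
    exact ⟨q, hq, m, hpm, hqm⟩

theorem exists_line_ne (h : IsGQ I s t) (ht : 2 ≤ t) (p : P) (ℓ : L) : ∃ m, I p m ∧ m ≠ ℓ := by
  by_contra hcon
  push Not at hcon
  have : Subsingleton {m : L // I p m} :=
    ⟨fun m m' => Subtype.ext ((hcon m m.2).trans (hcon m' m'.2).symm)⟩
  have := Finite.card_le_one_iff_subsingleton.2 this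
  rw [h.line_count p] at this
  omega

theorem coll_refl (h : IsGQ I s t) (ht : 2 ≤ t) (p : P) : Coll I p p := by
  have : Nonempty {m : L // I p m} := (Nat.card_pos_iff.1 (by rw [h.line_count p]; omega)).1
  obtain ⟨m, hm⟩ := this
  exact ⟨m, hm, hm⟩

theorem exists_point_ne (h : IsGQ I s t) (hs : 2 ≤ s) (ℓ : L) (a b : P) :
    ∃ p, I p ℓ ∧ p ≠ a ∧ p ≠ b := by
  by_contra hcon
  push Not at hcon
  have hsub : {p | I p ℓ} ⊆ ({a, b} : Set P) := by
    intro p hp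
    by_cases hpa : p = a
    · exact Or.inl hpa
    · exact Or.inr (hcon p hp hpa)
  have hle := Set.ncard_le_ncard hsub
  have h2 := Set.ncard_insert_le a {b}
  rw [Set.ncard_singleton] at h2
  have h3 : Set.ncard {p | I p ℓ} = s + 1 := h.point_count ℓ
  omega

theorem map_line_eq (h : IsGQ I s t) {g : Perm P × Perm L} (hg : g ∈ autGroup I) {p q : P}
    (hpq : p ≠ q) {ℓ : L} (hp : I p ℓ) (hq : I q ℓ) (hgp : g.1 p = p) (hgq : g.1 q = q) :
    g.2 ℓ = ℓ := by
  have h1 := (hg p ℓ).2 hp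
  have h2 := (hg q ℓ).2 hq
  rw [hgp] at h1
  rw [hgq] at h2
  exact h.unique_line hpq h1 h2 hp hq

variable {x y : P}

theorem trace_eq_of_coll (h : IsGQ I s t) (hxy : ¬ Coll I x y) {w w' : P}
    (hw : w ∈ perpSet I x ∩ perpSet I y) (hw' : w' ∈ perpSet I x ∩ perpSet I y) {ℓ : L}
    (hwℓ : I w ℓ) (hwℓ' : I w' ℓ) : w = w' := by
  by_cases hx : I x ℓ
  · by_cases hy : I y ℓ
    · exact absurd ⟨ℓ, hx, hy⟩ hxy
    · exact h.eq_of_coll hy hwℓ hwℓ' hw.2 hw'.2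
  · exact h.eq_of_coll hx hwℓ hwℓ' hw.1 hw'.1

theorem le_card_trace [Finite P] (h : IsGQ I s t) (hxy : ¬ Coll I x y) :
    t + 1 ≤ Nat.card ↥(perpSet I x ∩ perpSet I y) := by
  choose f hf hf' using fun m : L => h.exists_coll_on_line y m
  rw [← h.line_count x]
  refine Nat.card_le_card_of_injective
    (fun m : {m : L // I x m} => ⟨f m, ⟨m, m.2, hf m⟩, hf' m⟩) ?_
  intro m m' hmm
  have hmm' : f m = f m' := congrArg Subtype.val hmm
  have hne : x ≠ f m := fun e => hxy (e ▸ (hf' m).symm)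
  exact Subtype.ext (h.unique_line hne m.2 (hf m) m'.2 (hmm' ▸ hf m'))

theorem exists_trace_ne [Finite P] (h : IsGQ I s t) (ht : 2 ≤ t) (hxy : ¬ Coll I x y) (z : P) :
    ∃ w ∈ perpSet I x ∩ perpSet I y, w ≠ z := by
  by_contra hcon
  push Not at hcon
  have : Subsingleton ↥(perpSet I x ∩ perpSet I y) :=
    ⟨fun w w' => Subtype.ext ((hcon w w.2).trans (hcon w' w'.2).symm)⟩
  have h1 := Finite.card_le_one_iff_subsingleton.2 this
  have h2 := h.le_card_trace hxy
  omega

/-- Every line through a point of a hyperbolic line meets its trace. -/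
theorem exists_trace_on_line [Finite P] [Finite L] (h : IsGQ I s t) (hxy : ¬ Coll I x y) {u : P}
    (hu : u ∈ hypLine I x y) {ℓ : L} (hℓ : I u ℓ) : ∃ w ∈ perpSet I x ∩ perpSet I y, I w ℓ := by
  choose f hf hf' using fun w : ↥(perpSet I x ∩ perpSet I y) => hu w w.2
  have hinj : Function.Injective
      fun w : ↥(perpSet I x ∩ perpSet I y) => (⟨f w, hf w⟩ : {m : L // I u m}) := by
    intro w w' hww
    have hww' : f w = f w' := congrArg Subtype.val hww
    exact Subtype.ext (h.trace_eq_of_coll hxy w.2 w'.2 (hf' w) (hww' ▸ hf' w'))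
  have hbij := hinj.bijective_of_nat_card_le (by rw [h.line_count u]; exact h.le_card_trace hxy)
  obtain ⟨w, hw⟩ := hbij.2 ⟨ℓ, hℓ⟩
  have hw' : f w = ℓ := congrArg Subtype.val hw
  exact ⟨w, w.2, hw' ▸ hf' w⟩

theorem notMem_trace_of_mem_hypLine [Finite P] (h : IsGQ I s t) (ht : 2 ≤ t)
    (hxy : ¬ Coll I x y) {u : P} (hu : u ∈ hypLine I x y) :
    u ∉ perpSet I x ∩ perpSet I y := by
  intro hu'
  obtain ⟨z, hz, hzu⟩ := h.exists_trace_ne ht hxy u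
  obtain ⟨ℓ, hul, hzl⟩ := hu z hz
  exact hzu (h.trace_eq_of_coll hxy hz hu' hzl hul)

theorem hypLine_eq_of_coll [Finite P] [Finite L] (h : IsGQ I s t) (ht : 2 ≤ t)
    (hxy : ¬ Coll I x y) {u v : P} (hu : u ∈ hypLine I x y) (hv : v ∈ hypLine I x y) {ℓ : L}
    (hul : I u ℓ) (hvl : I v ℓ) : u = v := by
  obtain ⟨z, hz, hzl⟩ := h.exists_trace_on_line hxy hu hul
  obtain ⟨z', hz', hne⟩ := h.exists_trace_ne ht hxy z
  have hz'l : ¬ I z' ℓ := fun hl => hne (h.trace_eq_of_coll hxy hz' hz hl hzl)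
  exact h.eq_of_coll hz'l hul hvl (hu z' hz').symm (hv z' hz').symm

theorem exists_line_disjoint_trace [Finite P] (h : IsGQ I s t) (hs : 2 ≤ s) (ht : 2 ≤ t)
    (hxy : ¬ Coll I x y) : ∃ ℓ, ∀ z ∈ perpSet I x ∩ perpSet I y, ¬ I z ℓ := by
  obtain ⟨z, hz, -⟩ := h.exists_trace_ne ht hxy x
  obtain ⟨m, hxm, hzm⟩ := hz.1
  obtain ⟨p, hpm, hpx, hpz⟩ := h.exists_point_ne hs m x z
  obtain ⟨ℓ, hpl, hne⟩ := h.exists_line_ne ht p m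
  refine ⟨ℓ, fun w hw hwl => ?_⟩
  have hxl : ¬ I x ℓ := fun hx => hne (h.unique_line hpx hpl hx hpm hxm)
  have hwp : w = p := h.eq_of_coll hxl hwl hpl hw.1 ⟨m, hxm, hpm⟩
  exact hpz (h.trace_eq_of_coll hxy (hwp ▸ hw) hz hpm hzm)

end IsGQ

/-- The automorphisms fixing every point of `{x,y}^⊥`. -/
def traceFixer (I : P → L → Prop) (x y : P) : Subgroup (Perm P × Perm L) where
  carrier := {g | g ∈ autGroup I ∧ ∀ w ∈ perpSet I x ∩ perpSet I y, g.1 w = w}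
  one_mem' := ⟨(autGroup I).one_mem, fun _ _ => rfl⟩
  mul_mem' := by
    rintro a b ⟨ha, ha'⟩ ⟨hb, hb'⟩
    refine ⟨(autGroup I).mul_mem ha hb, fun w hw => ?_⟩
    rw [Prod.fst_mul, Perm.mul_apply, hb' w hw, ha' w hw]
  inv_mem' := by
    rintro a ⟨ha, ha'⟩
    refine ⟨(autGroup I).inv_mem ha, fun w hw => ?_⟩
    rw [Prod.fst_inv, Perm.inv_eq_iff_eq, ha' w hw]

variable {x y : P}

theorem iSup_symmGroup_le_traceFixer :
    (⨆ w ∈ hypLine I x y, symmGroup I w) ≤ traceFixer I x y :=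
  iSup₂_le fun _ hu _ he => ⟨he.1, fun w hw => he.2 w (hu w hw)⟩

theorem map_mem_hypLine {g : Perm P × Perm L} (hg : g ∈ traceFixer I x y) {u : P}
    (hu : u ∈ hypLine I x y) : g.1 u ∈ hypLine I x y := by
  intro w hw
  have h1 := (hu w hw).map hg.1
  rwa [hg.2 w hw] at h1

theorem map_disjoint_trace {g : Perm P × Perm L} (hg : g ∈ traceFixer I x y) {ℓ : L}
    (hℓ : ∀ z ∈ perpSet I x ∩ perpSet I y, ¬ I z ℓ) :
    ∀ z ∈ perpSet I x ∩ perpSet I y, ¬ I z (g.2 ℓ) := by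
  intro z hz hzl
  rw [← hg.2 z hz, hg.1 z ℓ] at hzl
  exact hℓ z hz hzl

theorem conj_mem_symmGroup {g e : Perm P × Perm L} {u : P} (hg : g ∈ autGroup I)
    (he : e ∈ symmGroup I u) : g * e * g⁻¹ ∈ symmGroup I (g.1 u) := by
  have hginv := (autGroup I).inv_mem hg
  refine ⟨(autGroup I).mul_mem ((autGroup I).mul_mem hg he.1) hginv, fun p hp => ?_⟩
  have h1 := hp.map hginv
  replace h1 : Coll I u (g.1.symm p) := by simpa using h1
  simp [he.2 _ h1]

namespace IsGQ

/-- An automorphism fixing the trace pointwise and fixing a point of the hyperbolic line fixes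
every line through that point. -/
theorem map_line_eq_of_mem_traceFixer [Finite P] [Finite L] (h : IsGQ I s t) (ht : 2 ≤ t)
    (hxy : ¬ Coll I x y) {g : Perm P × Perm L} (hg : g ∈ traceFixer I x y) {u : P}
    (hu : u ∈ hypLine I x y) (hgu : g.1 u = u) {ℓ : L} (hℓ : I u ℓ) : g.2 ℓ = ℓ := by
  obtain ⟨w, hw, hwl⟩ := h.exists_trace_on_line hxy hu hℓ
  have hne : u ≠ w := fun e => h.notMem_trace_of_mem_hypLine ht hxy hu (e ▸ hw)
  exact h.map_line_eq hg.1 hne hℓ hwl hgu (hg.2 w hw)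

/-- A symmetry with center on a hyperbolic line that fixes a line disjoint from the trace fixes
the hyperbolic line pointwise. -/
theorem map_eq_of_map_line_eq [Finite P] [Finite L] (h : IsGQ I s t) (ht : 2 ≤ t)
    (hxy : ¬ Coll I x y) {v : P} (hv : v ∈ hypLine I x y) {e : Perm P × Perm L}
    (he : e ∈ symmGroup I v) {ℓ : L} (hℓ : ∀ z ∈ perpSet I x ∩ perpSet I y, ¬ I z ℓ)
    (heℓ : e.2 ℓ = ℓ) {u : P} (hu : u ∈ hypLine I x y) : e.1 u = u := by
  have hmeet : ∀ w ∈ hypLine I x y, ¬ I w ℓ := by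
    intro w hw hwl
    obtain ⟨z, hz, hzl⟩ := h.exists_trace_on_line hxy hw hwl
    exact hℓ z hz hzl
  have hfixℓ : ∀ p, I p ℓ → e.1 p = p := by
    intro p hp
    obtain ⟨q, hq, m₀, hvm₀, hqm₀⟩ := h.exists_coll_on_line v ℓ
    obtain ⟨m, hvm, hne⟩ := h.exists_line_ne ht v m₀
    obtain ⟨n, hnm, hpn⟩ := h.exists_coll_on_line p m
    have hvn : Coll I v n := ⟨m, hvm, hnm⟩
    have hnl : ¬ I n ℓ := by
      intro hnl
      have hnq : n = q := h.eq_of_coll (hmeet v hv) hnl hq hvn ⟨m₀, hvm₀, hqm₀⟩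
      have hvq : v ≠ q := fun e => hmeet v hv (e ▸ hq)
      exact hne (h.unique_line hvq hvm (hnq ▸ hnm) hvm₀ hqm₀)
    have hep : I (e.1 p) ℓ := by
      have := (he.1 p ℓ).2 hp
      rwa [heℓ] at this
    have hnep : Coll I n (e.1 p) := by
      have := hpn.symm.map he.1
      rwa [he.2 n hvn] at this
    exact h.eq_of_coll hnl hep hp hnep hpn.symm
  obtain ⟨p, hp, k, huk, hpk⟩ := h.exists_coll_on_line u ℓ
  obtain ⟨z, hz, hzk⟩ := h.exists_trace_on_line hxy hu huk
  have hzp : z ≠ p := fun e => hℓ z hz (e ▸ hp)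
  have hek : e.2 k = k := h.map_line_eq he.1 hzp hzk hpk (he.2 z (hv z hz)) (hfixℓ p hp)
  have heuk : I (e.1 u) k := by
    have := (he.1 u k).2 huk
    rwa [hek] at this
  have hemem : e ∈ traceFixer I x y := ⟨he.1, fun w hw => he.2 w (hv w hw)⟩
  exact h.hypLine_eq_of_coll ht hxy (map_mem_hypLine hemem hu) hu heuk huk

/-- If nontrivial symmetries move all lines disjoint from the trace, then the product of two
nontrivial symmetries with distinct centers on the hyperbolic line is not a symmetry. -/
theorem mul_notMem_symmGroup [Finite P] [Finite L] (h : IsGQ I s t) (hs : 2 ≤ s) (ht : 2 ≤ t)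
    (hxy : ¬ Coll I x y)
    (hmove : ∀ u ∈ hypLine I x y, ∀ e ∈ symmGroup I u, e ≠ 1 →
      ∀ ℓ, (∀ z ∈ perpSet I x ∩ perpSet I y, ¬ I z ℓ) → e.2 ℓ ≠ ℓ)
    {u v w : P} (hu : u ∈ hypLine I x y) (hv : v ∈ hypLine I x y)
    (huv : u ≠ v) {a b : Perm P × Perm L} (ha : a ∈ symmGroup I u) (hb : b ∈ symmGroup I v)
    (ha1 : a ≠ 1) (hb1 : b ≠ 1) : a * b ∉ symmGroup I w := by
  intro hab
  obtain ⟨ℓ, hℓ⟩ := h.exists_line_disjoint_trace hs ht hxy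
  have hbfix : b ∈ traceFixer I x y := ⟨hb.1, fun z hz => hb.2 z (hv z hz)⟩
  have hℓb : b.2 ℓ ≠ ℓ := hmove v hv b hb hb1 ℓ hℓ
  have hbab : a.2 (b.2 ℓ) ≠ b.2 ℓ := hmove u hu a ha ha1 _ (map_disjoint_trace hbfix hℓ)
  obtain ⟨q₁, hq₁, hvq₁⟩ := h.exists_coll_on_line v ℓ
  obtain ⟨q₂, hq₂, huq₂⟩ := h.exists_coll_on_line u (b.2 ℓ)
  obtain ⟨q₃, hq₃, hwq₃⟩ := h.exists_coll_on_line w ℓ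
  have hq₁b : I q₁ (b.2 ℓ) := by
    have := (hb.1 q₁ ℓ).2 hq₁
    rwa [hb.2 q₁ hvq₁] at this
  have hq₂a : I q₂ (a.2 (b.2 ℓ)) := by
    have := (ha.1 q₂ (b.2 ℓ)).2 hq₂
    rwa [ha.2 q₂ huq₂] at this
  have hq₃ab : I q₃ (a.2 (b.2 ℓ)) := by
    have := (hab.1 q₃ ℓ).2 hq₃
    rwa [hab.2 q₃ hwq₃] at this
  have hq₁a : I q₁ (a.2 (b.2 ℓ)) := by
    by_contra hn
    have h23 : q₂ = q₃ := h.eq_of_coll hn hq₂a hq₃ab ⟨_, hq₁b, hq₂⟩ ⟨_, hq₁, hq₃⟩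
    have h12 : q₁ ≠ q₂ := fun e => hn (e ▸ hq₂a)
    exact hℓb (h.unique_line h12 hq₁b hq₂ hq₁ (h23 ▸ hq₃))
  have h12 : q₁ = q₂ := by
    by_contra hn
    exact hbab (h.unique_line hn hq₁a hq₂a hq₁b hq₂)
  obtain ⟨k, huk, hqk⟩ := huq₂
  rw [← h12] at hqk
  obtain ⟨z, hz, hzk⟩ := h.exists_trace_on_line hxy hu huk
  have hvk : ¬ I v k := fun hvk => huv (h.hypLine_eq_of_coll ht hxy hu hv huk hvk)
  have hzq : z = q₁ := h.eq_of_coll hvk hzk hqk (hv z hz) hvq₁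
  exact hℓ z hz (hzq ▸ hq₁)

end IsGQ

end Quadrangle

/-- The action of the group generated by the symmetries with center on a hyperbolic line on the
points of that hyperbolic line. -/
@[reducible]
def hypLineAction {P L : Type*} (I : P → L → Prop) (x y : P) :
    MulAction ↥(⨆ w ∈ hypLine I x y, symmGroup I w) (hypLine I x y) where
  smul g u := ⟨g.1.1 u, map_mem_hypLine (iSup_symmGroup_le_traceFixer g.2) u.2⟩
  one_smul _ := rfl
  mul_smul _ _ _ := rfl

/-- If `x` is an `r`-point and `y` is an `r'`-point for distinct primes `r ≠ r'`, with
`x, y` noncollinear, then there is a nontrivial homology in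
`⟨Ẽ(w) : w ∈ {x,y}^{⊥⊥}⟩` with both centers in `{x,y}^{⊥⊥}`. -/
theorem exists_homology {P L : Type} [Finite P] [Finite L]
    (I : P → L → Prop) (s t : ℕ) (hGQ : IsGQ I s t) (hs : 2 ≤ s) (ht : 2 ≤ t)
    (r r' : ℕ) (hr : r.Prime) (hr' : r'.Prime) (hrr' : r ≠ r')
    (x y : P) (hxy : ¬ Coll I x y)
    (hx : r ∣ Nat.card (symmGroup I x)) (hy : r' ∣ Nat.card (symmGroup I y)) :
    ∃ u ∈ hypLine I x y, ∃ v ∈ hypLine I x y, u ≠ v ∧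
      ∃ g ∈ (⨆ w ∈ hypLine I x y, symmGroup I w), g ≠ 1 ∧
        (∀ ℓ : L, I u ℓ → g.2 ℓ = ℓ) ∧ (∀ ℓ : L, I v ℓ → g.2 ℓ = ℓ) := by
  by_contra hcon
  set G := ⨆ w ∈ hypLine I x y, symmGroup I w
  have hle : ∀ w ∈ hypLine I x y, symmGroup I w ≤ G := fun w hw =>
    le_iSup₂ (f := fun w (_ : w ∈ hypLine I x y) => symmGroup I w) w hw
  have hno : ∀ g ∈ G, g ≠ 1 → ∀ u ∈ hypLine I x y, ∀ v ∈ hypLine I x y,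
      g.1 u = u → g.1 v = v → u = v := by
    intro g hg hg1 u hu v hv hgu hgv
    by_contra huv
    have hgX := iSup_symmGroup_le_traceFixer hg
    exact hcon ⟨u, hu, v, hv, huv, g, hg, hg1,
      fun ℓ => hGQ.map_line_eq_of_mem_traceFixer ht hxy hgX hu hgu,
      fun ℓ => hGQ.map_line_eq_of_mem_traceFixer ht hxy hgX hv hgv⟩
  have hxH : x ∈ hypLine I x y := fun w hw => hw.1
  have hyH : y ∈ hypLine I x y := fun w hw => hw.2
  have hne : x ≠ y := fun e => hxy (e ▸ hGQ.coll_refl ht x)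
  have hmove : ∀ u ∈ hypLine I x y, ∀ e ∈ symmGroup I u, e ≠ 1 →
      ∀ ℓ, (∀ z ∈ perpSet I x ∩ perpSet I y, ¬ I z ℓ) → e.2 ℓ ≠ ℓ :=
    fun u hu e he he1 ℓ hℓ heℓ => hne (hno e (hle u hu he) he1 x hxH y hyH
      (hGQ.map_eq_of_map_line_eq ht hxy hu he hℓ heℓ hxH)
      (hGQ.map_eq_of_map_line_eq ht hxy hu he hℓ heℓ hyH))
  have := Fact.mk hr
  have := Fact.mk hr'
  obtain ⟨⟨a, ha⟩, haord⟩ := exists_prime_orderOf_dvd_card' r hx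
  obtain ⟨⟨b, hb⟩, hbord⟩ := exists_prime_orderOf_dvd_card' r' hy
  rw [Subgroup.orderOf_mk] at haord hbord
  have ha1 : a ≠ 1 := by
    rintro rfl
    exact hr.one_lt.ne (orderOf_one.symm.trans haord)
  have hb1 : b ≠ 1 := by
    rintro rfl
    exact hr'.one_lt.ne (orderOf_one.symm.trans hbord)
  have haG : a ∈ G := hle x hxH ha
  have hbG : b ∈ G := hle y hyH hb
  let := hypLineAction I x y
  obtain ⟨w, hw⟩ := exists_mul_mem_of_coprime (G := G) (X := hypLine I x y)
    (fun g hg u v hu hv => Subtype.ext (hno g g.2 (fun e => hg (Subtype.ext e)) u u.2 v v.2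
      (congrArg Subtype.val hu) (congrArg Subtype.val hv)))
    (fun u => (symmGroup I (u : P)).subgroupOf G)
    (fun u e he => Subtype.ext ((Subgroup.mem_subgroupOf.1 he).2 u (hGQ.coll_refl ht u)))
    (fun g u e he => Subgroup.mem_subgroupOf.2
      (conj_mem_symmGroup (iSup_symmGroup_le_traceFixer g.2).1 (Subgroup.mem_subgroupOf.1 he)))
    (x := ⟨x, hxH⟩) (y := ⟨y, hyH⟩) (a := ⟨a, haG⟩) (b := ⟨b, hbG⟩)
    (Subgroup.mem_subgroupOf.2 ha) (Subgroup.mem_subgroupOf.2 hb)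
    (fun e => ha1 (congrArg Subtype.val e)) (fun e => hb1 (congrArg Subtype.val e))
    (by rw [Subgroup.orderOf_mk, Subgroup.orderOf_mk, haord, hbord]
        exact (Nat.coprime_primes hr hr').2 hrr')
  exact hGQ.mul_notMem_symmGroup hs ht hxy hmove hxH hyH hne ha hb ha1 hb1
    (Subgroup.mem_subgroupOf.1 hw)
end

section
/- Let S be a finite thick generalized quadrangle. Assume that for each point p a nontrivial group E(p) of symmetries with center p is given, that there is a prime r dividing |E(p)| for every point p, and set G = ⟨E(p) : p a point⟩. Then for every line ℓ, the setwise stabilizer G_ℓ of ℓ in G acts 2-transitively on the set of points incident with ℓ. -/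
open Equiv

namespace IsGQ

variable {P L : Type*} {I : P → L → Prop} {s t : ℕ}

theorem coll_comm {x y : P} : Coll I x y ↔ Coll I y x :=
  exists_congr fun _ => and_comm

/-- A generalized quadrangle contains no triangles. -/
theorem incident_of_coll (h : IsGQ I s t) {p a b : P} {m : L} (ha : I a m) (hb : I b m)
    (hab : a ≠ b) (hpa : Coll I p a) (hpb : Coll I p b) : I p m := by
  by_contra hp
  obtain ⟨k, hk, hk'⟩ := hpa
  obtain ⟨n, hn, hn'⟩ := hpb
  have e := (h.quad hp).unique (y₁ := (a, k)) (y₂ := (b, n)) ⟨hk, hk', ha⟩ ⟨hn, hn', hb⟩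
  exact hab (congrArg Prod.fst e)

theorem exists_incident_coll (h : IsGQ I s t) (p : P) (m : L) : ∃ q, I q m ∧ Coll I p q := by
  by_cases hp : I p m
  · exact ⟨p, hp, m, hp, hp⟩
  · obtain ⟨⟨q, k⟩, ⟨h1, h2, h3⟩, -⟩ := h.quad hp
    exact ⟨q, h3, k, h1, h2⟩

theorem exists_third_point [Finite P] (h : IsGQ I s t) (hs : 2 ≤ s) (m : L) (a b : P) :
    ∃ c, I c m ∧ c ≠ a ∧ c ≠ b := by
  by_contra! hc
  have h1 : Set.ncard {p | I p m} = s + 1 := h.point_count m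
  have h2 : Set.ncard {p | I p m} ≤ Set.ncard {a, b} :=
    Set.ncard_le_ncard (fun p hp => by
      by_cases hpa : p = a
      · exact Or.inl hpa
      · exact Or.inr (hc p hp hpa)) (Set.toFinite _)
  have h3 := Set.ncard_insert_le a {b}
  rw [Set.ncard_singleton] at h3
  omega

theorem exists_line (h : IsGQ I s t) (p : P) : ∃ m, I p m := by
  have hne : Nonempty {m : L // I p m} := (Nat.card_pos_iff.1 (by rw [h.line_count]; omega)).1
  exact ⟨hne.some.1, hne.some.2⟩

theorem exists_other_line [Finite L] (h : IsGQ I s t) (ht : 2 ≤ t) (p : P) (m : L) :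
    ∃ k, I p k ∧ k ≠ m := by
  by_contra! hc
  have h1 : Set.ncard {k | I p k} = t + 1 := h.line_count p
  have h2 : Set.ncard {k | I p k} ≤ Set.ncard {m} :=
    Set.ncard_le_ncard (fun k hk => hc k hk) (Set.toFinite _)
  rw [Set.ncard_singleton] at h2
  omega

theorem line_fixed (h : IsGQ I s t) {g : Perm P × Perm L} (hg : g ∈ autGroup I) {a b : P} {m : L}
    (ha : I a m) (hb : I b m) (hab : a ≠ b) (hga : g.1 a = a) (hgb : g.1 b = b) :
    g.2 m = m := by
  have h1 := (hg a m).2 ha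
  have h2 := (hg b m).2 hb
  rw [hga] at h1
  rw [hgb] at h2
  exact h.unique_line hab h1 h2 ha hb

theorem coll_map {g : Perm P × Perm L} (hg : g ∈ autGroup I) {a b : P} (hab : Coll I a b) :
    Coll I (g.1 a) (g.1 b) := by
  obtain ⟨m, ha, hb⟩ := hab
  exact ⟨g.2 m, (hg _ _).2 ha, (hg _ _).2 hb⟩

/-- A symmetry with center `p` fixing a point `z` not collinear with `p` fixes every point
collinear with `z`. -/
theorem fixes_perp_of_fixes [Finite L] (h : IsGQ I s t) (ht : 2 ≤ t) {p z : P}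
    {g : Perm P × Perm L} (hg : g ∈ symmGroup I p) (hz : ¬ Coll I p z) (hgz : g.1 z = z)
    {w : P} (hw : Coll I z w) : g.1 w = w := by
  obtain ⟨hga, hgp⟩ := hg
  obtain ⟨n, hzn, hwn⟩ := hw
  obtain ⟨q, hqn, m, hpm, hqm⟩ := h.exists_incident_coll p n
  have hpn : ¬ I p n := fun hp => hz ⟨n, hp, hzn⟩
  have hgq : g.1 q = q := hgp q ⟨m, hpm, hqm⟩
  have hzq : z ≠ q := by rintro rfl; exact hz ⟨m, hpm, hqm⟩
  have hgn : g.2 n = n := h.line_fixed hga hzn hqn hzq hgz hgq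
  have hgw : I (g.1 w) n := by simpa [hgn] using (hga w n).2 hwn
  obtain ⟨k, hpk, hkm⟩ := h.exists_other_line ht p m
  obtain ⟨c, hck, hwc⟩ := h.exists_incident_coll w k
  have hgc : g.1 c = c := hgp c ⟨k, hpk, hck⟩
  by_contra hne
  have hgwc : Coll I (g.1 w) c := by simpa [hgc] using coll_map hga hwc
  have hcn : I c n := h.incident_of_coll hgw hwn hne (coll_comm.1 hgwc) (coll_comm.1 hwc)
  have hqp : p ≠ q := by rintro rfl; exact hpn hqn
  have hcq : c = q := by
    by_contra hcq
    exact hpn (h.incident_of_coll hcn hqn hcq ⟨k, hpk, hck⟩ ⟨m, hpm, hqm⟩)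
  subst hcq
  exact hkm (h.unique_line hqp hpk hck hpm hqm)

/-- A symmetry with center `p` fixing a point not collinear with `p` fixes every point, since the
points not collinear with `p` are connected by collinearity. -/
theorem fixes_all_of_fixes [Finite P] [Finite L] (h : IsGQ I s t) (hs : 2 ≤ s) (ht : 2 ≤ t)
    {p z : P} {g : Perm P × Perm L} (hg : g ∈ symmGroup I p) (hz : ¬ Coll I p z)
    (hgz : g.1 z = z) (w : P) : g.1 w = w := by
  by_cases hpw : Coll I p w
  · exact hg.2 w hpw
  by_cases hzw : Coll I z w
  · exact h.fixes_perp_of_fixes ht hg hz hgz hzw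
  by_cases hex : ∃ e, Coll I z e ∧ Coll I w e ∧ ¬ Coll I p e
  · obtain ⟨e, hze, hwe, hpe⟩ := hex
    exact h.fixes_perp_of_fixes ht hg hpe (h.fixes_perp_of_fixes ht hg hz hgz hze)
      (coll_comm.1 hwe)
  push Not at hex
  obtain ⟨n, hzn⟩ := h.exists_line z
  obtain ⟨q, hqn, hwq⟩ := h.exists_incident_coll w n
  have hzq : z ≠ q := by rintro rfl; exact hzw (coll_comm.1 hwq)
  have hpq : Coll I p q := hex q ⟨n, hzn, hqn⟩ hwq
  obtain ⟨z', hz'n, hz'z, hz'q⟩ := h.exists_third_point hs n z q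
  have hpz' : ¬ Coll I p z' := fun hc =>
    hz ⟨n, h.incident_of_coll hz'n hqn hz'q hc hpq, hzn⟩
  have hwn : ¬ I w n := fun hwn => hzw ⟨n, hzn, hwn⟩
  have hgz' := h.fixes_perp_of_fixes ht hg hz hgz ⟨n, hzn, hz'n⟩
  obtain ⟨k, hz'k, hkn⟩ := h.exists_other_line ht z' n
  obtain ⟨d, hdk, m, hwm, hdm⟩ := h.exists_incident_coll w k
  have hz'd : Coll I z' d := ⟨k, hz'k, hdk⟩
  have hpd : ¬ Coll I p d := by
    intro hpd
    obtain ⟨e, hem, hze⟩ := h.exists_incident_coll z m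
    have hpe : Coll I p e := hex e hze ⟨m, hwm, hem⟩
    have hde : d = e := by
      by_contra hde
      exact hpw ⟨m, h.incident_of_coll hdm hem hde hpd hpe, hwm⟩
    subst hde
    have hdn : I d n := h.incident_of_coll hzn hz'n hz'z.symm (coll_comm.1 hze) (coll_comm.1 hz'd)
    by_cases hdz' : d = z'
    · subst hdz'
      exact hwn (h.incident_of_coll hz'n hqn hz'q ⟨m, hwm, hdm⟩ hwq)
    · exact hkn (h.unique_line hdz' hdk hz'k hdn hz'n)
  have hgd := h.fixes_perp_of_fixes ht hg hpz' hgz' hz'd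
  exact h.fixes_perp_of_fixes ht hg hpd hgd ⟨m, hdm, hwm⟩

theorem eq_one_of_fixes_points [Finite P] (h : IsGQ I s t) (hs : 2 ≤ s)
    {g : Perm P × Perm L} (hg : g ∈ autGroup I) (hfix : ∀ w, g.1 w = w) : g = 1 := by
  refine Prod.ext (Equiv.ext hfix) (Equiv.ext fun m => ?_)
  have hne : Nonempty {p : P // I p m} := (Nat.card_pos_iff.1 (by rw [h.point_count]; omega)).1
  obtain ⟨a, ha⟩ := hne.some
  obtain ⟨b, hb, hba, -⟩ := h.exists_third_point hs m a a
  exact h.line_fixed hg hb ha hba (hfix b) (hfix a)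

/-- Nontrivial symmetries with center `p` fix no point outside `p^⊥`. -/
theorem coll_of_fixed [Finite P] [Finite L] (h : IsGQ I s t) (hs : 2 ≤ s) (ht : 2 ≤ t)
    {p z : P} {g : Perm P × Perm L} (hg : g ∈ symmGroup I p) (hg1 : g ≠ 1)
    (hgz : g.1 z = z) : Coll I p z := by
  by_contra hz
  exact hg1 (h.eq_one_of_fixes_points hs hg.1 (h.fixes_all_of_fixes hs ht hg hz hgz))

/-- Distinct points of a hyperbolic line are not collinear. -/
theorem eq_of_mem_hypLine_of_coll [Finite L] (h : IsGQ I s t) (ht : 2 ≤ t) {u v w : P}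
    (huv : ¬ Coll I u v) (hw : w ∈ hypLine I u v) (hwu : Coll I w u) : w = u := by
  obtain ⟨m, hwm, hum⟩ := hwu
  by_contra hne
  obtain ⟨k, huk, hkm⟩ := h.exists_other_line ht u m
  obtain ⟨c, hck, hvc⟩ := h.exists_incident_coll v k
  have hcu : c ≠ u := by rintro rfl; exact huv (coll_comm.1 hvc)
  have hwk : I w k := h.incident_of_coll hck huk hcu (hw c ⟨⟨k, huk, hck⟩, hvc⟩) ⟨m, hwm, hum⟩
  exact hkm (h.unique_line hne hwk huk hwm hum)

end IsGQ

/-- If two permutations of prime exponent `r` preserve a finite set `O`, and the first has `u`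
as its only fixed point in `O` while the second fixes at most `v` in `O`, then `v` lies in `O`. -/
theorem mem_of_unique_fixed_points {P : Type*} [Finite P] {r : ℕ} (hr : r.Prime)
    {A B : Perm P} (hA : A ^ r = 1) (hB : B ^ r = 1) {O : Set P} (hAO : ∀ w ∈ O, A w ∈ O)
    (hBO : ∀ w ∈ O, B w ∈ O) {u v : P} (hu : u ∈ O) (hAu : A u = u)
    (hAfix : ∀ w ∈ O, A w = w → w = u) (hBfix : ∀ w ∈ O, B w = w → w = v) : v ∈ O := by
  classical
  by_contra hv
  have : Fact r.Prime := ⟨hr⟩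
  have : Fintype P := Fintype.ofFinite P
  have card_modEq : ∀ (C : Perm P) (hC : ∀ w ∈ O, C w ∈ O), C ^ r = 1 →
      Fintype.card O ≡ Fintype.card
        (Function.fixedPoints (fun w : O => (⟨C w, hC w w.2⟩ : O))) [MOD r] := by
    intro C hC hCr
    let f : Function.End O := fun w => ⟨C w, hC w w.2⟩
    have key : ∀ (n : ℕ) (w : O), ((f ^ n) w : P) = (C ^ n) w := by
      intro n
      induction n with
      | zero => intro w; rfl
      | succ n ih =>
        intro w
        rw [pow_succ, pow_succ]
        exact ih _
    refine Equiv.Perm.card_fixedPoints_modEq (f := f) (n := 1) ?_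
    funext w
    apply Subtype.ext
    rw [key, pow_one, hCr]
    rfl
  have h1 := card_modEq A hAO hA
  have h2 := card_modEq B hBO hB
  have c1 : Fintype.card (Function.fixedPoints (fun w : O => (⟨A w, hAO w w.2⟩ : O))) = 1 := by
    refine Fintype.card_eq_one_iff.2 ⟨⟨⟨u, hu⟩, Subtype.ext hAu⟩, ?_⟩
    rintro ⟨⟨w, hw⟩, hwf⟩
    exact Subtype.ext (Subtype.ext (hAfix w hw (congrArg Subtype.val hwf)))
  have c2 : Fintype.card (Function.fixedPoints (fun w : O => (⟨B w, hBO w w.2⟩ : O))) = 0 := by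
    refine Fintype.card_eq_zero_iff.2 ⟨?_⟩
    rintro ⟨⟨w, hw⟩, hwf⟩
    exact hv (hBfix w hw (congrArg Subtype.val hwf) ▸ hw)
  rw [c1] at h1
  rw [c2] at h2
  have h3 : r ∣ 1 := (Nat.modEq_zero_iff_dvd).1 (h1.symm.trans h2)
  exact hr.one_lt.ne' (Nat.dvd_one.1 h3)

namespace IsGQ

variable {P L : Type*} {I : P → L → Prop} {s t : ℕ}

/-- Two symmetries of prime order `r` with noncollinear centers `u` and `v` generate a group
which contains an element fixing `{u,v}^⊥` pointwise and mapping `u` to `v`. -/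
theorem exists_mem_closure_map_eq [Finite P] [Finite L] (h : IsGQ I s t) (hs : 2 ≤ s)
    (ht : 2 ≤ t) {r : ℕ} (hr : r.Prime) {u v : P} (huv : ¬ Coll I u v) {a b : Perm P × Perm L}
    (ha : a ∈ symmGroup I u) (hb : b ∈ symmGroup I v) (har : orderOf a = r)
    (hbr : orderOf b = r) :
    ∃ k ∈ Subgroup.closure {a, b}, (∀ c ∈ perpSet I u ∩ perpSet I v, k.1 c = c) ∧ k.1 u = v := by
  have hKaut : Subgroup.closure {a, b} ≤ autGroup I := by
    rw [Subgroup.closure_le]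
    rintro k (rfl | rfl)
    exacts [ha.1, hb.1]
  have hKfix : ∀ k ∈ Subgroup.closure {a, b}, ∀ c ∈ perpSet I u ∩ perpSet I v, k.1 c = c := by
    intro k hk c hc
    have : Subgroup.closure {a, b} ≤ stabPt (⊤ : Subgroup (Perm P × Perm L)) c := by
      rw [Subgroup.closure_le]
      rintro k (rfl | rfl)
      exacts [⟨trivial, ha.2 c hc.1⟩, ⟨trivial, hb.2 c hc.2⟩]
    exact (this hk).2
  have haK : a ∈ Subgroup.closure {a, b} := Subgroup.subset_closure (Or.inl rfl)
  have hbK : b ∈ Subgroup.closure {a, b} := Subgroup.subset_closure (Or.inr rfl)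
  have hne : ∀ k : Perm P × Perm L, orderOf k = r → k ≠ 1 := by
    rintro k hk rfl
    exact hr.one_lt.ne (orderOf_one.symm.trans hk)
  have hperm : ∀ k : Perm P × Perm L, orderOf k = r → k.1 ^ r = 1 := by
    intro k hk
    have := pow_orderOf_eq_one k
    rw [hk] at this
    exact congrArg Prod.fst this
  let O : Set P := {w | ∃ k ∈ Subgroup.closure {a, b}, k.1 u = w}
  have hOhyp : ∀ w ∈ O, w ∈ hypLine I u v := by
    rintro w ⟨k, hk, rfl⟩ c hc
    have := coll_map (hKaut hk) (show Coll I u c from hc.1)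
    rwa [hKfix k hk c hc] at this
  have hswap : hypLine I u v = hypLine I v u := by
    unfold hypLine
    rw [Set.inter_comm]
  have hmem : v ∈ O := by
    refine mem_of_unique_fixed_points hr (hperm a har) (hperm b hbr) (u := u) ?_ ?_
      ⟨1, one_mem _, rfl⟩ ?_ ?_ ?_
    · rintro w ⟨k, hk, rfl⟩
      exact ⟨a * k, mul_mem haK hk, rfl⟩
    · rintro w ⟨k, hk, rfl⟩
      exact ⟨b * k, mul_mem hbK hk, rfl⟩
    · obtain ⟨m, hm⟩ := h.exists_line u
      exact ha.2 u ⟨m, hm, hm⟩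
    · intro w hw haw
      exact h.eq_of_mem_hypLine_of_coll ht huv (hOhyp w hw)
        (coll_comm.1 (h.coll_of_fixed hs ht ha (hne a har) haw))
    · intro w hw hbw
      exact h.eq_of_mem_hypLine_of_coll ht (fun hc => huv (coll_comm.1 hc))
        (hswap ▸ hOhyp w hw) (coll_comm.1 (h.coll_of_fixed hs ht hb (hne b hbr) hbw))
  obtain ⟨k, hk, hku⟩ := hmem
  exact ⟨k, hk, hKfix k hk, hku⟩

/-- A group containing symmetries of prime order `r` about every point has, for each point `x`
of a line `ℓ`, a stabilizer of `x` and `ℓ` transitive on the other points of `ℓ`. -/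
theorem exists_fix_map_eq [Finite P] [Finite L] (h : IsGQ I s t) (hs : 2 ≤ s) (ht : 2 ≤ t)
    {r : ℕ} (hr : r.Prime) {G : Subgroup (Perm P × Perm L)} (hG : G ≤ autGroup I)
    (hsym : ∀ p, ∃ a ∈ G, a ∈ symmGroup I p ∧ orderOf a = r) {ℓ : L} {x y z : P}
    (hx : I x ℓ) (hy : I y ℓ) (hz : I z ℓ) (hyx : y ≠ x) (hzx : z ≠ x) :
    ∃ g ∈ G, g.2 ℓ = ℓ ∧ g.1 x = x ∧ g.1 y = z := by
  obtain ⟨m, hxm, hm⟩ := h.exists_other_line ht x ℓ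
  obtain ⟨v, hvm, hvx, -⟩ := h.exists_third_point hs m x x
  have hnc : ∀ w, I w ℓ → w ≠ x → ¬ Coll I w v := fun w hw hwx hc =>
    hm (h.unique_line hwx
      (h.incident_of_coll hvm hxm hvx hc ⟨ℓ, hw, hx⟩) hxm hw hx)
  have hmove : ∀ u w : P, ¬ Coll I u w → Coll I u x → Coll I w x →
      ∃ g ∈ G, g.1 x = x ∧ g.1 u = w := by
    intro u w huw hux hwx
    obtain ⟨a, haG, ha, har⟩ := hsym u
    obtain ⟨b, hbG, hb, hbr⟩ := hsym w
    obtain ⟨k, hk, hfix, hku⟩ := h.exists_mem_closure_map_eq hs ht hr huw ha hb har hbr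
    refine ⟨k, ?_, hfix x ⟨hux, hwx⟩, hku⟩
    refine (Subgroup.closure_le G).2 ?_ hk
    rintro k (rfl | rfl) <;> assumption
  obtain ⟨g, hgG, hgx, hgy⟩ := hmove y v (hnc y hy hyx) ⟨ℓ, hy, hx⟩ ⟨m, hvm, hxm⟩
  obtain ⟨k, hkG, hkx, hkz⟩ := hmove v z (fun hc => hnc z hz hzx (coll_comm.1 hc))
    ⟨m, hvm, hxm⟩ ⟨ℓ, hz, hx⟩
  have hkg : k * g ∈ G := mul_mem hkG hgG
  have e1 : (k * g).1 x = x := by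
    change k.1 (g.1 x) = x
    rw [hgx, hkx]
  have e2 : (k * g).1 y = z := by
    change k.1 (g.1 y) = z
    rw [hgy, hkz]
  refine ⟨k * g, hkg, ?_, e1, e2⟩
  have i1 := (hG hkg x ℓ).2 hx
  have i2 := (hG hkg y ℓ).2 hy
  rw [e1] at i1
  rw [e2] at i2
  exact h.unique_line hzx i2 i1 hz hx

end IsGQ

/-- Given nontrivial groups `E(p)` of symmetries with all orders divisible by a prime `r`
and `G = ⟨E(p) : p⟩`, the setwise stabilizer `G_ℓ` of any line `ℓ` acts `2`-transitively
on the points of `ℓ`. -/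
theorem stabLine_two_transitive {P L : Type} [Finite P] [Finite L]
    (I : P → L → Prop) (s t : ℕ) (hGQ : IsGQ I s t) (hs : 2 ≤ s) (ht : 2 ≤ t)
    (E : P → Subgroup (Equiv.Perm P × Equiv.Perm L))
    (hEsym : ∀ p : P, E p ≤ symmGroup I p) (hEnt : ∀ p : P, E p ≠ ⊥)
    (r : ℕ) (hr : r.Prime) (hdiv : ∀ p : P, r ∣ Nat.card (E p))
    (ℓ : L) :
    ∀ x y x' y' : P, I x ℓ → I y ℓ → I x' ℓ → I y' ℓ → x ≠ y → x' ≠ y' →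
      ∃ g ∈ (⨆ p : P, E p : Subgroup (Equiv.Perm P × Equiv.Perm L)),
        g.2 ℓ = ℓ ∧ g.1 x = x' ∧ g.1 y = y' := by
  intro x y x' y' hx hy hx' hy' hxy hxy'
  have hG : (⨆ p : P, E p) ≤ autGroup I :=
    iSup_le fun p => (hEsym p).trans fun _ hg => hg.1
  have hsym : ∀ p, ∃ a ∈ (⨆ p : P, E p), a ∈ symmGroup I p ∧ orderOf a = r := by
    intro p
    have : Fact r.Prime := ⟨hr⟩
    obtain ⟨a, ha⟩ := exists_prime_orderOf_dvd_card' r (hdiv p)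
    exact ⟨a, le_iSup E p a.2, hEsym p a.2, (Subgroup.orderOf_coe a).trans ha⟩
  have hmove : ∃ g ∈ (⨆ p : P, E p), g.2 ℓ = ℓ ∧ g.1 x = x' := by
    obtain ⟨z, hz, hzx, hzx'⟩ := hGQ.exists_third_point hs ℓ x x'
    obtain ⟨g, hg, hgℓ, -, hgx⟩ :=
      hGQ.exists_fix_map_eq hs ht hr hG hsym hz hx hx' hzx.symm hzx'.symm
    exact ⟨g, hg, hgℓ, hgx⟩
  obtain ⟨g, hg, hgℓ, hgx⟩ := hmove
  have hgy : I (g.1 y) ℓ := by simpa [hgℓ] using (hG hg y ℓ).2 hy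
  have hgyx : g.1 y ≠ x' := by
    rw [← hgx]
    exact fun hc => hxy (g.1.injective hc).symm
  obtain ⟨k, hk, hkℓ, hkx, hky⟩ :=
    hGQ.exists_fix_map_eq hs ht hr hG hsym hx' hgy hy' hgyx hxy'.symm
  refine ⟨k * g, mul_mem hk hg, ?_, ?_, ?_⟩
  · change k.2 (g.2 ℓ) = ℓ
    rw [hgℓ, hkℓ]
  · change k.1 (g.1 x) = x'
    rw [hgx, hkx]
  · exact hky
end
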